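/- arXiv:2009.06853 — 4 statements merged into one kernel-verified Lean document; each statement's English description precedes it below -/
import Mathlib

section
/- Let P be a simple 𝔖-module such that I_k acts injectively on P for some k ∈ ℤ≥0. Then the following conditions are equivalent: (1) there exists z ∈ ℤ≥0 such that the actions of L_i, G_i, I_i on P are locally finite for all i ≥ z; (2) there exists z ∈ ℤ≥0 such that the actions of L_i, G_i, I_i on P are locally nilpotent for all i ≥ z; (3) there exist r, s, t ∈ ℤ≥0 such that P is a locally finite 𝔖^{(r,s,t)}-module; (4) there exist r, s, t ∈ ℤ≥0 such that P is a locally nilpotent 𝔖^{(r,s,t)}-module; (5) there exist α, β, z ∈ ℤ≥0 with α ≥ 2β and a simple 𝔖_{α,β}-module V on which I_z acts injectively and with L_i V = 0 (i > z+α), G_j V = 0 (j > z+β), I_k V = 0 (k > z), such that P ≅ Ind(V). -/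
/-- Basis of the super Heisenberg-Virasoro algebra of Ramond type 𝔖:
`l m = L_m`, `i m = I_m`, `g m = G_m`. -/
inductive SB : Type
  | l : ℤ → SB
  | i : ℤ → SB
  | g : ℤ → SB
  deriving DecidableEq

/-- The underlying space of 𝔖: formal finite ℂ-linear combinations of basis elements. -/
abbrev SHV : Type := SB →₀ ℂ

/-- Parity: `L_m, I_m` are even, `G_m` is odd. -/
def par : SB → ZMod 2
  | .g _ => 1
  | _ => 0

/-- The bracket of 𝔖 on basis elements:
`[L_m, L_n] = (n-m)L_{m+n}`, `[L_m, I_n] = n I_{m+n}`, `[L_m, G_n] = n G_{m+n}`,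
`[G_m, G_n] = 2 I_{m+n}`, all other brackets of basis elements vanish. -/
noncomputable def sb : SB → SB → SHV
  | .l m, .l n => ((n : ℂ) - (m : ℂ)) • Finsupp.single (.l (m + n)) 1
  | .l m, .i n => (n : ℂ) • Finsupp.single (.i (m + n)) 1
  | .i m, .l n => (-(m : ℂ)) • Finsupp.single (.i (m + n)) 1
  | .l m, .g n => (n : ℂ) • Finsupp.single (.g (m + n)) 1
  | .g m, .l n => (-(m : ℂ)) • Finsupp.single (.g (m + n)) 1
  | .g m, .g n => (2 : ℂ) • Finsupp.single (.i (m + n)) 1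
  | _, _ => 0

/-- The bracket of 𝔖, extended bilinearly to the whole space. -/
noncomputable def br (x y : SHV) : SHV :=
  x.sum fun a ca => y.sum fun b cb => (ca * cb) • sb a b

/-- The sign `(-1)^{|a||b|}`. -/
noncomputable def sgn (a b : SB) : ℂ := if par a = 1 ∧ par b = 1 then -1 else 1

/-- A ℤ₂-graded representation of the subalgebra of 𝔖 spanned by the set `Q` of basis
elements (for `Q = Set.univ` this is a module over 𝔖 itself): a ℤ₂-graded complex vector
space with a parity-respecting action of the basis elements of `Q` satisfying the
super-commutation relations dictated by the bracket `sb`. -/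
structure GRep (Q : Set SB) : Type 1 where
  V : Type
  [acg : AddCommGroup V]
  [mod : Module ℂ V]
  act : SB → V →ₗ[ℂ] V
  grade : ZMod 2 → Submodule ℂ V
  grade_sup : ∀ v : V, ∃ v0 ∈ grade 0, ∃ v1 ∈ grade 1, v = v0 + v1
  grade_inf : grade 0 ⊓ grade 1 = ⊥
  act_grade : ∀ a ∈ Q, ∀ p : ZMod 2, ∀ v ∈ grade p, act a v ∈ grade (par a + p)
  act_br : ∀ a ∈ Q, ∀ b ∈ Q, ∀ v : V,
    act a (act b v) - sgn a b • act b (act a v) = (sb a b).sum fun c cc => cc • act c v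

attribute [instance] GRep.acg GRep.mod

/-- A (graded) submodule of a graded representation: a subspace stable under the action
and generated by its homogeneous components. -/
def IsSub {Q : Set SB} (ρ : GRep Q) (U : Submodule ℂ ρ.V) : Prop :=
  (∀ a ∈ Q, ∀ v ∈ U, ρ.act a v ∈ U) ∧
  ∀ v ∈ U, ∃ v0, v0 ∈ U ∧ v0 ∈ ρ.grade 0 ∧ ∃ v1, v1 ∈ U ∧ v1 ∈ ρ.grade 1 ∧ v = v0 + v1

/-- Simplicity: nonzero, and the only graded submodules are `⊥` and `⊤`. -/
def IsSimple {Q : Set SB} (ρ : GRep Q) : Prop :=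
  (∃ v : ρ.V, v ≠ 0) ∧ ∀ U : Submodule ℂ ρ.V, IsSub ρ U → U = ⊥ ∨ U = ⊤

/-- A linear map between graded representations which is even and `Q`-equivariant. -/
def SEquivMap (Q : Set SB) {Q1 Q2 : Set SB} (ρ : GRep Q1) (σ : GRep Q2)
    (f : ρ.V →ₗ[ℂ] σ.V) : Prop :=
  (∀ a ∈ Q, ∀ v : ρ.V, f (ρ.act a v) = σ.act a (f v)) ∧
  ∀ p : ZMod 2, ∀ v ∈ ρ.grade p, f v ∈ σ.grade p

/-- `(M, ι)` is the representation induced from the `Q`-representation `ρ` to the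
subalgebra spanned by `Q'` (i.e. `M = U(𝔤_{Q'}) ⊗_{U(𝔤_Q)} ρ`), characterized by its
universal property. -/
def IsInduced (Q : Set SB) {Q' : Set SB} (ρ : GRep Q) (M : GRep Q')
    (ι : ρ.V →ₗ[ℂ] M.V) : Prop :=
  SEquivMap Q ρ M ι ∧
  ∀ (N : GRep Q') (f : ρ.V →ₗ[ℂ] N.V), SEquivMap Q ρ N f →
    ∃! F : M.V →ₗ[ℂ] N.V, SEquivMap Q' M N F ∧ F ∘ₗ ι = f

/-- Basis of the subalgebra 𝔖_{α,β} = span{L_i, I_{i-α}, G_{i-β} : i ≥ 0}. -/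
def QS (α β : ℕ) : Set SB := fun x =>
  match x with
  | .l m => 0 ≤ m
  | .i m => -(α : ℤ) ≤ m
  | .g m => -(β : ℤ) ≤ m

/-- Basis of the subalgebra 𝔖^{(r,s,t)} = span{L_i : i ≥ r} ∪ {I_i : i ≥ s} ∪ {G_i : i ≥ t}. -/
def Qrst (r s t : ℕ) : Set SB := fun x =>
  match x with
  | .l m => (r : ℤ) ≤ m
  | .i m => (s : ℤ) ≤ m
  | .g m => (t : ℤ) ≤ m

/-- Basis of T(r) = 𝔖^{(r,r,r)}. -/
def T (r : ℕ) : Set SB := Qrst r r r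

/-- A restricted 𝔖-module. -/
def IsRestricted (ρ : GRep (Set.univ : Set SB)) : Prop :=
  ∀ w : ρ.V, ∃ k : ℕ, ∀ i : ℤ, (k : ℤ) < i →
    ρ.act (.l i) w = 0 ∧ ρ.act (.g i) w = 0 ∧ ρ.act (.i i) w = 0

/-- Local nilpotency of the action of a single operator. -/
def LocNil {W : Type} [AddCommGroup W] [Module ℂ W] (f : W →ₗ[ℂ] W) : Prop :=
  ∀ v : W, ∃ n : ℕ, (f ^ n) v = 0

/-- Local finiteness of the action of a single operator. -/
def LocFin {W : Type} [AddCommGroup W] [Module ℂ W] (f : W →ₗ[ℂ] W) : Prop :=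
  ∀ v : W, FiniteDimensional ℂ (Submodule.span ℂ (Set.range fun n : ℕ => (f ^ n) v))

/-- Local finiteness of the action of the subalgebra spanned by `Q` on a module:
for every `v`, the span of all iterated actions of elements of `Q` on `v` is
finite-dimensional. -/
def AlgLocFin (Q : Set SB) (ρ : GRep (Set.univ : Set SB)) : Prop :=
  ∀ v : ρ.V, FiniteDimensional ℂ (Submodule.span ℂ
    {w : ρ.V | ∃ l : List SB, (∀ a ∈ l, a ∈ Q) ∧ w = l.foldr (fun a u => ρ.act a u) v})

/-- Local nilpotency of the action of the subalgebra spanned by `Q` on a module: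
for every `v` there is `n` such that every product of `n` elements of `Q` kills `v`. -/
def AlgLocNil (Q : Set SB) (ρ : GRep (Set.univ : Set SB)) : Prop :=
  ∀ v : ρ.V, ∃ n : ℕ, ∀ l : List SB, (∀ a ∈ l, a ∈ Q) → l.length = n →
    l.foldr (fun a u => ρ.act a u) v = 0

section Operators

variable {M : Type*} [AddCommGroup M] [Module ℂ M]

/-- A family of operators satisfying the super-commutation relations of 𝔖. -/
def SatisfiesBrackets (act : SB → M →ₗ[ℂ] M) : Prop :=
  ∀ a b v, act a (act b v) - sgn a b • act b (act a v) = (sb a b).sum fun c cc => cc • act c v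

/-- A subspace stable under all the operators `act a`. -/
def IsStable (act : SB → M →ₗ[ℂ] M) (U : Submodule ℂ M) : Prop :=
  ∀ a, ∀ v ∈ U, act a v ∈ U

/-- The degree of a basis element with respect to the natural ℤ-grading of 𝔖. -/
def SB.deg : SB → ℤ
  | .l m => m
  | .i m => m
  | .g m => m

theorem deg_of_mem_support_sb {a b c : SB} (hc : c ∈ (sb a b).support) :
    c.deg = a.deg + b.deg := by
  cases a <;> cases b <;> simp only [sb, Finsupp.smul_single, Finsupp.support_zero] at hc <;>
    first
    | exact absurd hc (Finset.notMem_empty _)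
    | (have := Finsupp.support_single_subset hc
       rw [Finset.mem_singleton] at this
       subst this
       rfl)

variable {act : SB → M →ₗ[ℂ] M}

namespace SatisfiesBrackets

theorem ll (h : SatisfiesBrackets act) (m n : ℤ) (v : M) :
    act (.l m) (act (.l n) v) =
      act (.l n) (act (.l m) v) + ((n : ℂ) - m) • act (.l (m + n)) v := by
  have := h (.l m) (.l n) v
  rw [sub_eq_iff_eq_add'] at this
  simpa [sb, sgn, par, -Finsupp.single_sub] using this

theorem li (h : SatisfiesBrackets act) (m n : ℤ) (v : M) :
    act (.l m) (act (.i n) v) = act (.i n) (act (.l m) v) + (n : ℂ) • act (.i (m + n)) v := by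
  have := h (.l m) (.i n) v
  rw [sub_eq_iff_eq_add'] at this
  simpa [sb, sgn, par] using this

theorem lg (h : SatisfiesBrackets act) (m n : ℤ) (v : M) :
    act (.l m) (act (.g n) v) = act (.g n) (act (.l m) v) + (n : ℂ) • act (.g (m + n)) v := by
  have := h (.l m) (.g n) v
  rw [sub_eq_iff_eq_add'] at this
  simpa [sb, sgn, par] using this

theorem ii (h : SatisfiesBrackets act) (m n : ℤ) (v : M) :
    act (.i m) (act (.i n) v) = act (.i n) (act (.i m) v) := by
  have := h (.i m) (.i n) v
  rw [sub_eq_iff_eq_add'] at this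
  simpa [sb, sgn, par] using this

theorem ig (h : SatisfiesBrackets act) (m n : ℤ) (v : M) :
    act (.i m) (act (.g n) v) = act (.g n) (act (.i m) v) := by
  have := h (.i m) (.g n) v
  rw [sub_eq_iff_eq_add'] at this
  simpa [sb, sgn, par] using this

theorem gg (h : SatisfiesBrackets act) (m n : ℤ) (v : M) :
    act (.g m) (act (.g n) v) = -act (.g n) (act (.g m) v) + (2 : ℂ) • act (.i (m + n)) v := by
  have := h (.g m) (.g n) v
  rw [sub_eq_iff_eq_add'] at this
  simpa [sb, sgn, par] using this

theorem comm_eq (h : SatisfiesBrackets act) (a b : SB) (v : M) :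
    act a (act b v) =
      sgn a b • act b (act a v) + (sb a b).sum fun c cc => cc • act c v := by
  rw [← h a b v, add_sub_cancel]

/-- A submodule containing `act b (act a v)` and all `act c v` with `deg c = deg a + deg b`
contains `act a (act b v)`. -/
theorem act_act_mem (h : SatisfiesBrackets act) {a b : SB} {v : M} {U : Submodule ℂ M}
    (h1 : act b (act a v) ∈ U) (h2 : ∀ c : SB, c.deg = a.deg + b.deg → act c v ∈ U) :
    act a (act b v) ∈ U := by
  rw [h.comm_eq]
  exact U.add_mem (U.smul_mem _ h1)
    (U.sum_mem fun c hc => U.smul_mem _ (h2 c (deg_of_mem_support_sb hc)))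

theorem prodMap {N : Type*} [AddCommGroup N] [Module ℂ N] {act' : SB → N →ₗ[ℂ] N}
    (h : SatisfiesBrackets act) (h' : SatisfiesBrackets act') :
    SatisfiesBrackets fun a => (act a).prodMap (act' a) := by
  intro a b v
  refine Prod.ext ?_ ?_
  · have := h a b v.1
    simpa [Finsupp.sum, Prod.fst_sum] using this
  · have := h' a b v.2
    simpa [Finsupp.sum, Prod.snd_sum] using this

end SatisfiesBrackets

/-- The vectors killed by all products of `n` operators `act a` with `a ∈ Q`. -/
def nilLayer (act : SB → M →ₗ[ℂ] M) (Q : Set SB) : ℕ → Submodule ℂ M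
  | 0 => ⊥
  | n + 1 => ⨅ a ∈ Q, (nilLayer act Q n).comap (act a)

theorem mem_nilLayer_succ {Q : Set SB} {n : ℕ} {v : M} :
    v ∈ nilLayer act Q (n + 1) ↔ ∀ a ∈ Q, act a v ∈ nilLayer act Q n := by
  simp [nilLayer, Submodule.mem_iInf]

theorem nilLayer_mono (Q : Set SB) : Monotone (nilLayer act Q) := by
  refine monotone_nat_of_le_succ fun n => ?_
  induction n with
  | zero => exact bot_le
  | succ n ih =>
    intro v hv
    rw [mem_nilLayer_succ] at hv ⊢
    exact fun a ha => ih (hv a ha)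

/-- The vectors on which the operators `act a`, `a ∈ Q`, act nilpotently. -/
def nilPart (act : SB → M →ₗ[ℂ] M) (Q : Set SB) : Submodule ℂ M :=
  ⨆ n, nilLayer act Q n

theorem mem_nilPart {Q : Set SB} {v : M} : v ∈ nilPart act Q ↔ ∃ n, v ∈ nilLayer act Q n :=
  Submodule.mem_iSup_of_directed _ (nilLayer_mono Q).directed_le

theorem exists_act_mem_nilLayer (h : SatisfiesBrackets act) {Q : Set SB} {D : ℤ}
    (hpos : ∀ a ∈ Q, 1 ≤ a.deg) (hD : ∀ a : SB, D ≤ a.deg → a ∈ Q) (c n : ℕ) :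
    ∃ n', ∀ a : SB, D - c ≤ a.deg → ∀ v ∈ nilLayer act Q n, act a v ∈ nilLayer act Q n' := by
  induction c generalizing n with
  | zero =>
    refine ⟨n, fun a ha v hv => ?_⟩
    have hv' := nilLayer_mono Q n.le_succ hv
    exact mem_nilLayer_succ.1 hv' a (hD a (by simpa using ha))
  | succ c ihc =>
    induction n with
    | zero =>
      refine ⟨0, fun a _ v hv => ?_⟩
      have : v = 0 := by simpa [nilLayer] using hv
      simp [this]
    | succ n ihn =>
      obtain ⟨n1, h1⟩ := ihn
      obtain ⟨n2, h2⟩ := ihc (n + 1)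
      refine ⟨max n1 n2 + 1, fun a ha v hv => mem_nilLayer_succ.2 fun b hb => ?_⟩
      refine h.act_act_mem ?_ fun d hd => ?_
      · exact nilLayer_mono Q (le_max_left _ _) (h1 a ha _ (mem_nilLayer_succ.1 hv b hb))
      · refine nilLayer_mono Q (le_max_right _ _) (h2 d ?_ v hv)
        have := hpos b hb
        push_cast at ha
        lia

theorem isStable_nilPart (h : SatisfiesBrackets act) {Q : Set SB} {D : ℤ}
    (hpos : ∀ a ∈ Q, 1 ≤ a.deg) (hD : ∀ a : SB, D ≤ a.deg → a ∈ Q) :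
    IsStable act (nilPart act Q) := by
  intro a v hv
  obtain ⟨n, hn⟩ := mem_nilPart.1 hv
  obtain ⟨n', hn'⟩ := exists_act_mem_nilLayer h hpos hD (D - a.deg).toNat n
  exact mem_nilPart.2 ⟨n', hn' a (by lia) v hn⟩

/-- A nonzero stable subspace on which `Q` acts nilpotently contains a nonzero vector
killed by `Q`. -/
theorem exists_ne_zero_killed {Q : Set SB} {S : Submodule ℂ M}
    (hS : ∀ a ∈ Q, ∀ v ∈ S, act a v ∈ S) {v : M} (hv : v ∈ S) (hv0 : v ≠ 0)
    (hn : v ∈ nilPart act Q) : ∃ w ∈ S, w ≠ 0 ∧ ∀ a ∈ Q, act a w = 0 := by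
  obtain ⟨n, hn⟩ := mem_nilPart.1 hn
  induction n generalizing v with
  | zero => exact absurd (by simpa [nilLayer] using hn) hv0
  | succ n ih =>
    by_cases hk : ∀ a ∈ Q, act a v = 0
    · exact ⟨v, hv, hv0, hk⟩
    · push Not at hk
      obtain ⟨a, ha, hav⟩ := hk
      exact ih (hS a ha v hv) hav (mem_nilPart.2 ⟨n, mem_nilLayer_succ.1 hn a ha⟩)
        (mem_nilLayer_succ.1 hn a ha)

/-- The vectors killed by all `act a` with `k ≤ deg a`. -/
def killedFrom (act : SB → M →ₗ[ℂ] M) (k : ℕ) : Submodule ℂ M :=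
  ⨅ a : SB, ⨅ _ : (k : ℤ) ≤ a.deg, LinearMap.ker (act a)

theorem mem_killedFrom {k : ℕ} {v : M} :
    v ∈ killedFrom act k ↔ ∀ a : SB, (k : ℤ) ≤ a.deg → act a v = 0 := by
  simp [killedFrom, Submodule.mem_iInf]

theorem killedFrom_mono : Monotone (killedFrom act) := fun k k' hk v hv =>
  mem_killedFrom.2 fun a ha => mem_killedFrom.1 hv a (le_trans (by exact_mod_cast hk) ha)

/-- The vectors killed by all `act a` with `deg a` large enough. -/
def restrictedPart (act : SB → M →ₗ[ℂ] M) : Submodule ℂ M := ⨆ k, killedFrom act k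

theorem mem_restrictedPart {v : M} :
    v ∈ restrictedPart act ↔ ∃ k : ℕ, ∀ a : SB, (k : ℤ) ≤ a.deg → act a v = 0 := by
  simp_rw [← mem_killedFrom]
  exact Submodule.mem_iSup_of_directed _ killedFrom_mono.directed_le

theorem isStable_restrictedPart (h : SatisfiesBrackets act) :
    IsStable act (restrictedPart act) := by
  intro a v hv
  obtain ⟨k, hk⟩ := mem_restrictedPart.1 hv
  refine mem_restrictedPart.2 ⟨k + (-a.deg).toNat, fun b hb => ?_⟩
  push_cast at hb
  rw [← Submodule.mem_bot ℂ]
  refine h.act_act_mem ?_ fun c hc => ?_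
  · rw [hk b (by lia), map_zero]
    exact zero_mem _
  · rw [hk c (by lia)]
    exact zero_mem _

end Operators

section Orbit

variable {M : Type*} [AddCommGroup M] [Module ℂ M]

/-- The sum of the images of `Y` under `B ^ k`, `k < n`. -/
def powSpan (B : M →ₗ[ℂ] M) (Y : Submodule ℂ M) : ℕ → Submodule ℂ M
  | 0 => ⊥
  | n + 1 => powSpan B Y n ⊔ Y.map (B ^ n)

/-- The smallest `B`-stable subspace containing `Y`. -/
def orbitSpan (B : M →ₗ[ℂ] M) (Y : Submodule ℂ M) : Submodule ℂ M := ⨆ n, powSpan B Y n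

variable {A B Z : M →ₗ[ℂ] M} {Y U : Submodule ℂ M} {c : ℂ}

theorem powSpan_mono : Monotone (powSpan B Y) :=
  monotone_nat_of_le_succ fun _ => le_sup_left

theorem mem_orbitSpan {x : M} : x ∈ orbitSpan B Y ↔ ∃ n, x ∈ powSpan B Y n :=
  Submodule.mem_iSup_of_directed _ powSpan_mono.directed_le

theorem map_powSpan_le (n : ℕ) : (powSpan B Y n).map B ≤ powSpan B Y (n + 1) := by
  induction n with
  | zero => simp [powSpan]
  | succ n ih =>
    rw [powSpan, Submodule.map_sup, ← Submodule.map_comp]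
    refine sup_le (ih.trans (powSpan_mono (Nat.le_succ _))) ?_
    rw [← Module.End.mul_eq_comp, ← pow_succ']
    exact le_sup_right

theorem orbitSpan_stable {x : M} (hx : x ∈ orbitSpan B Y) : B x ∈ orbitSpan B Y := by
  obtain ⟨n, hn⟩ := mem_orbitSpan.1 hx
  exact mem_orbitSpan.2 ⟨n + 1, map_powSpan_le n (Submodule.mem_map_of_mem hn)⟩

theorem le_orbitSpan : Y ≤ orbitSpan B Y := fun y hy =>
  mem_orbitSpan.2 ⟨1, by simpa [powSpan] using hy⟩

theorem orbitSpan_le (hY : Y ≤ U) (hB : ∀ x ∈ orbitSpan B Y, x ∈ U → B x ∈ U) :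
    orbitSpan B Y ≤ U := by
  have key : ∀ n, ∀ y ∈ Y, (B ^ n) y ∈ U ∧ (B ^ n) y ∈ orbitSpan B Y := by
    intro n y hy
    induction n with
    | zero => exact ⟨hY hy, le_orbitSpan hy⟩
    | succ n ih =>
      rw [pow_succ', Module.End.mul_apply]
      exact ⟨hB _ ih.2 ih.1, orbitSpan_stable ih.2⟩
  refine iSup_le fun n => ?_
  induction n with
  | zero => exact bot_le
  | succ n ih => exact sup_le ih (Submodule.map_le_iff_le_comap.2 fun y hy => (key n y hy).1)

section Lowering

variable (hAB : ∀ x, A (B x) = B (A x) + c • Z x) (hZB : ∀ x, Z (B x) = B (Z x))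
  (hAY : ∀ y ∈ Y, A y = 0) (hZY : ∀ y ∈ Y, Z y ∈ Y)

include hAB hZB hAY in
theorem lower_pow_succ {y : M} (hy : y ∈ Y) (k : ℕ) :
    A ((B ^ (k + 1)) y) = ((k + 1 : ℕ) * c) • (B ^ k) (Z y) := by
  have hZ : ∀ k, Z ((B ^ k) y) = (B ^ k) (Z y) := by
    intro k
    induction k with
    | zero => rfl
    | succ k ih => rw [pow_succ', Module.End.mul_apply, hZB, ih, Module.End.mul_apply]
  induction k with
  | zero => simp [hAB, hAY y hy]
  | succ k ih =>
    rw [pow_succ', Module.End.mul_apply, hAB, ih, hZ, map_smul, ← Module.End.mul_apply B,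
      ← pow_succ', ← add_smul]
    push_cast
    ring_nf

include hAB hZB hAY hZY in
theorem pow_lower_pow {y : M} (hy : y ∈ Y) (k : ℕ) :
    (A ^ k) ((B ^ k) y) = ((k.factorial : ℂ) * c ^ k) • (Z ^ k) y := by
  induction k generalizing y with
  | zero => simp
  | succ k ih =>
    rw [pow_succ, Module.End.mul_apply, lower_pow_succ hAB hZB hAY hy, map_smul,
      ih (hZY y hy), smul_smul, pow_succ Z, Module.End.mul_apply, Nat.factorial_succ]
    push_cast
    ring_nf

include hZY in
theorem pow_mem_of_stable {y : M} (hy : y ∈ Y) (k : ℕ) : (Z ^ k) y ∈ Y := by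
  induction k with
  | zero => exact hy
  | succ k ih =>
    rw [pow_succ', Module.End.mul_apply]
    exact hZY _ ih

include hZY in
theorem eq_zero_of_stable_pow_eq_zero (hinj : ∀ y ∈ Y, Z y = 0 → y = 0) {y : M} (hy : y ∈ Y) {k : ℕ}
    (h : (Z ^ k) y = 0) : y = 0 := by
  induction k with
  | zero => exact h
  | succ k ih =>
    rw [pow_succ', Module.End.mul_apply] at h
    exact ih (hinj _ (pow_mem_of_stable hZY hy k) h)

include hAB hZB hAY hZY in
theorem pow_lower_powSpan {x : M} {k : ℕ} (hx : x ∈ powSpan B Y k) : (A ^ k) x = 0 := by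
  induction k generalizing x with
  | zero => simpa [powSpan] using hx
  | succ k ih =>
    obtain ⟨x', hx', w, ⟨y, hy, rfl⟩, rfl⟩ := Submodule.mem_sup.1 hx
    rw [pow_succ', Module.End.mul_apply, map_add, ih hx', zero_add,
      pow_lower_pow hAB hZB hAY hZY hy, map_smul, hAY _ (pow_mem_of_stable hZY hy k), smul_zero]

include hAB hZB hAY hZY in
/-- A vector of the `B`-orbit of `Y` killed by the lowering operator `A` lies in `Y`. -/
theorem mem_of_lower_eq_zero (hc : c ≠ 0) (hinj : ∀ y ∈ Y, Z y = 0 → y = 0) {x : M}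
    (hx : x ∈ orbitSpan B Y) (hAx : A x = 0) : x ∈ Y := by
  obtain ⟨n, hn⟩ := mem_orbitSpan.1 hx
  induction n generalizing x with
  | zero =>
    have : x = 0 := by simpa [powSpan] using hn
    simp [this]
  | succ n ih =>
    obtain ⟨x', hxU, w, ⟨y, hy, rfl⟩, rfl⟩ := Submodule.mem_sup.1 hn
    cases n with
    | zero =>
      have : x' = 0 := by simpa [powSpan] using hxU
      simpa [this] using hy
    | succ n =>
      have h0 : (A ^ (n + 1)) (x' + (B ^ (n + 1)) y) = 0 := by
        rw [pow_succ, Module.End.mul_apply, hAx, map_zero]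
      rw [map_add, pow_lower_powSpan hAB hZB hAY hZY hxU, zero_add,
        pow_lower_pow hAB hZB hAY hZY hy, smul_eq_zero] at h0
      have hy0 : y = 0 := eq_zero_of_stable_pow_eq_zero hZY hinj hy (h0.resolve_left
        (mul_ne_zero (Nat.cast_ne_zero.2 (Nat.factorial_ne_zero _)) (pow_ne_zero _ hc)))
      subst hy0
      rw [map_zero, add_zero] at hAx hx ⊢
      exact ih hx hAx hxU

include hAB hZB hAY hZY in
/-- If `Z` is injective on `Y`, then it is injective on the `B`-orbit of `Y`. -/
theorem orbitSpan_injective (hc : c ≠ 0) (hinj : ∀ y ∈ Y, Z y = 0 → y = 0) {x : M}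
    (hx : x ∈ orbitSpan B Y) (hZx : Z x = 0) : x = 0 := by
  obtain ⟨n, hn⟩ := mem_orbitSpan.1 hx
  have hZpow : ∀ (k : ℕ) (y : M), Z ((B ^ k) y) = (B ^ k) (Z y) := by
    intro k y
    induction k with
    | zero => rfl
    | succ k ih => rw [pow_succ', Module.End.mul_apply, hZB, ih, Module.End.mul_apply]
  have hZspan : ∀ k, ∀ x ∈ powSpan B Y k, Z x ∈ powSpan B Y k := by
    intro k
    induction k with
    | zero => simp [powSpan]
    | succ k ih =>
      intro x hx
      obtain ⟨x', hx', w, ⟨y, hy, rfl⟩, rfl⟩ := Submodule.mem_sup.1 hx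
      rw [map_add, hZpow]
      exact Submodule.add_mem_sup (ih _ hx') (Submodule.mem_map_of_mem (hZY y hy))
  induction n generalizing x with
  | zero => simpa [powSpan] using hn
  | succ n ih =>
    obtain ⟨x', hx', w, ⟨y, hy, rfl⟩, rfl⟩ := Submodule.mem_sup.1 hn
    have h0 : (A ^ n) (Z (x' + (B ^ n) y)) = 0 := by rw [hZx, map_zero]
    rw [map_add, hZpow, map_add, pow_lower_powSpan hAB hZB hAY hZY (hZspan _ _ hx'), zero_add,
      pow_lower_pow hAB hZB hAY hZY (hZY y hy), smul_eq_zero] at h0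
    have hy0 : y = 0 := hinj y hy (eq_zero_of_stable_pow_eq_zero hZY hinj (hZY y hy) (h0.resolve_left
        (mul_ne_zero (Nat.cast_ne_zero.2 (Nat.factorial_ne_zero _)) (pow_ne_zero _ hc))))
    subst hy0
    rw [map_zero, add_zero] at hZx hx ⊢
    exact ih hx hZx hx'

end Lowering

end Orbit

section InducedLayers

variable {M : Type*} [AddCommGroup M] [Module ℂ M] {act : SB → M →ₗ[ℂ] M} {α β z : ℕ}
  {Y : Submodule ℂ M}

/-- `Y` is an 𝔖_{α,β}-stable subspace, killed by `L_j` (`j > z + α`), `G_j` (`j > z + β`) and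
`I_j` (`j > z`), on which `I_z` is injective. -/
structure IsSingular (act : SB → M →ₗ[ℂ] M) (α β z : ℕ) (Y : Submodule ℂ M) : Prop where
  l_mem : ∀ j : ℤ, 0 ≤ j → ∀ y ∈ Y, act (.l j) y ∈ Y
  i_mem : ∀ j : ℤ, -(α : ℤ) ≤ j → ∀ y ∈ Y, act (.i j) y ∈ Y
  g_mem : ∀ j : ℤ, -(β : ℤ) ≤ j → ∀ y ∈ Y, act (.g j) y ∈ Y
  l_zero : ∀ j : ℤ, (z : ℤ) + α < j → ∀ y ∈ Y, act (.l j) y = 0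
  i_zero : ∀ j : ℤ, (z : ℤ) < j → ∀ y ∈ Y, act (.i j) y = 0
  g_zero : ∀ j : ℤ, (z : ℤ) + β < j → ∀ y ∈ Y, act (.g j) y = 0
  i_inj : ∀ y ∈ Y, act (.i z) y = 0 → y = 0

/-- `Y` is stable under all `I_j`, `G_j` (`j ≥ -β`) and `L_j` (`j ≥ 0`), killed by `G_j`
(`j > z + β`) and `I_j` (`j > z`), and `I_z` is injective on it. -/
structure IsISingular (act : SB → M →ₗ[ℂ] M) (β z : ℕ) (Y : Submodule ℂ M) : Prop where
  l_mem : ∀ j : ℤ, 0 ≤ j → ∀ y ∈ Y, act (.l j) y ∈ Y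
  i_mem : ∀ j : ℤ, ∀ y ∈ Y, act (.i j) y ∈ Y
  g_mem : ∀ j : ℤ, -(β : ℤ) ≤ j → ∀ y ∈ Y, act (.g j) y ∈ Y
  i_zero : ∀ j : ℤ, (z : ℤ) < j → ∀ y ∈ Y, act (.i j) y = 0
  g_zero : ∀ j : ℤ, (z : ℤ) + β < j → ∀ y ∈ Y, act (.g j) y = 0
  i_inj : ∀ y ∈ Y, act (.i z) y = 0 → y = 0

/-- `Y` is stable under all `I_j`, `G_j` and under `L_j` (`j ≥ 0`), killed by `I_j` (`j > z`),
and `I_z` is injective on it. -/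
structure IsIGSingular (act : SB → M →ₗ[ℂ] M) (z : ℕ) (Y : Submodule ℂ M) : Prop where
  l_mem : ∀ j : ℤ, 0 ≤ j → ∀ y ∈ Y, act (.l j) y ∈ Y
  i_mem : ∀ j : ℤ, ∀ y ∈ Y, act (.i j) y ∈ Y
  g_mem : ∀ j : ℤ, ∀ y ∈ Y, act (.g j) y ∈ Y
  i_zero : ∀ j : ℤ, (z : ℤ) < j → ∀ y ∈ Y, act (.i j) y = 0
  i_inj : ∀ y ∈ Y, act (.i z) y = 0 → y = 0

theorem lower_i_identity (h : SatisfiesBrackets act) (α z : ℕ) (x : M) :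
    act (.l (z + α + 1)) (act (.i (-(α + 1 : ℤ))) x) =
      act (.i (-(α + 1 : ℤ))) (act (.l (z + α + 1)) x) + (-(α + 1 : ℂ)) • act (.i z) x := by
  rw [h.li, show (z + α + 1 : ℤ) + -(α + 1 : ℤ) = z by ring]
  push_cast
  rfl

theorem IsSingular.orbit (h : SatisfiesBrackets act) (hY : IsSingular act α β z Y) :
    IsSingular act (α + 1) β z (orbitSpan (act (.i (-(α + 1 : ℤ)))) Y) := by
  have hi : ∀ j : ℤ, -((α + 1 : ℕ) : ℤ) ≤ j →
      ∀ y ∈ orbitSpan (act (.i (-(α + 1 : ℤ)))) Y,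
        act (.i j) y ∈ orbitSpan (act (.i (-(α + 1 : ℤ)))) Y := by
    intro j hj
    rcases eq_or_lt_of_le hj with rfl | hj
    · intro y hy
      exact_mod_cast orbitSpan_stable hy
    · refine orbitSpan_le (U := Submodule.comap (act (.i j)) (orbitSpan (act (.i (-(α + 1 : ℤ)))) Y))
        (fun y hy => le_orbitSpan (hY.i_mem j (by push_cast at hj; lia) y hy)) fun x _ hx => ?_
      rw [Submodule.mem_comap] at hx ⊢
      rw [h.ii]
      exact orbitSpan_stable hx
  have hi0 : ∀ j : ℤ, (z : ℤ) < j →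
      ∀ y ∈ orbitSpan (act (.i (-(α + 1 : ℤ)))) Y, act (.i j) y = 0 := by
    intro j hj
    refine orbitSpan_le (U := LinearMap.ker (act (.i j))) (fun y hy => hY.i_zero j hj y hy)
      fun x _ hx => ?_
    rw [LinearMap.mem_ker] at hx ⊢
    rw [h.ii, hx, map_zero]
  refine ⟨?_, hi, ?_, ?_, hi0, ?_, ?_⟩
  · intro j hj
    refine orbitSpan_le (U := Submodule.comap (act (.l j)) (orbitSpan (act (.i (-(α + 1 : ℤ)))) Y))
        (fun y hy => le_orbitSpan (hY.l_mem j hj y hy)) fun x hxo hx => ?_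
    rw [Submodule.mem_comap] at hx ⊢
    rw [h.li]
    exact add_mem (orbitSpan_stable hx) (Submodule.smul_mem _ _ (hi _ (by push_cast; lia) x hxo))
  · intro j hj
    refine orbitSpan_le (U := Submodule.comap (act (.g j)) (orbitSpan (act (.i (-(α + 1 : ℤ)))) Y))
        (fun y hy => le_orbitSpan (hY.g_mem j hj y hy)) fun x hxo hx => ?_
    rw [Submodule.mem_comap] at hx ⊢
    rw [← h.ig]
    exact orbitSpan_stable hx
  · intro j hj
    refine orbitSpan_le (U := LinearMap.ker (act (.l j)))
      (fun y hy => hY.l_zero j (by push_cast at hj; lia) y hy) fun x hxo hx => ?_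
    rw [LinearMap.mem_ker] at hx ⊢
    rw [h.li, hx, map_zero, hi0 _ (by push_cast at hj; lia) x hxo, smul_zero, add_zero]
  · intro j hj
    refine orbitSpan_le (U := LinearMap.ker (act (.g j)))
      (fun y hy => hY.g_zero j hj y hy) fun x _ hx => ?_
    rw [LinearMap.mem_ker] at hx ⊢
    rw [← h.ig, hx, map_zero]
  · intro y hy hy0
    exact orbitSpan_injective (A := act (.l (z + α + 1))) (Z := act (.i z))
      (lower_i_identity h α z) (fun x => h.ii _ _ x)
      (fun y hy => hY.l_zero _ (by lia) y hy) (fun y hy => hY.i_mem _ (by lia) y hy)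
      (neg_ne_zero.2 (Nat.cast_add_one_ne_zero α)) hY.i_inj hy hy0

theorem IsSingular.mem_of_mem_orbit (h : SatisfiesBrackets act) (hY : IsSingular act α β z Y)
    {x : M} (hx : x ∈ orbitSpan (act (.i (-(α + 1 : ℤ)))) Y)
    (h0 : act (.l (z + α + 1)) x = 0) : x ∈ Y :=
  mem_of_lower_eq_zero (A := act (.l (z + α + 1))) (Z := act (.i z))
      (lower_i_identity h α z) (fun x => h.ii _ _ x)
      (fun y hy => hY.l_zero _ (by lia) y hy) (fun y hy => hY.i_mem _ (by lia) y hy)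
      (neg_ne_zero.2 (Nat.cast_add_one_ne_zero α)) hY.i_inj hx h0

/-- The subspace generated by `Y` under `I_j`, `j ≥ -(α + n)`. -/
def iLayer (act : SB → M →ₗ[ℂ] M) (α : ℕ) (Y : Submodule ℂ M) : ℕ → Submodule ℂ M
  | 0 => Y
  | n + 1 => orbitSpan (act (.i (-((α + n : ℕ) + 1 : ℤ)))) (iLayer act α Y n)

theorem iLayer_mono : Monotone (iLayer act α Y) :=
  monotone_nat_of_le_succ fun _ => le_orbitSpan

theorem IsSingular.iLayer (h : SatisfiesBrackets act) (hY : IsSingular act α β z Y) (n : ℕ) :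
    IsSingular act (α + n) β z (iLayer act α Y n) := by
  induction n with
  | zero => exact hY
  | succ n ih => exact ih.orbit h

/-- The subspace generated by `Y` under all `I_j`. -/
def iSpan (act : SB → M →ₗ[ℂ] M) (α : ℕ) (Y : Submodule ℂ M) : Submodule ℂ M :=
  ⨆ n, iLayer act α Y n

theorem mem_iSpan {x : M} : x ∈ iSpan act α Y ↔ ∃ n, x ∈ iLayer act α Y n :=
  Submodule.mem_iSup_of_directed _ iLayer_mono.directed_le

theorem IsSingular.iSpan (h : SatisfiesBrackets act) (hY : IsSingular act α β z Y) :
    IsISingular act β z (iSpan act α Y) := by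
  refine ⟨?_, ?_, ?_, ?_, ?_, ?_⟩ <;> intro j
  · intro hj y hy
    obtain ⟨n, hn⟩ := mem_iSpan.1 hy
    exact mem_iSpan.2 ⟨n, (hY.iLayer h n).l_mem j hj y hn⟩
  · intro y hy
    obtain ⟨n, hn⟩ := mem_iSpan.1 hy
    exact mem_iSpan.2 ⟨n + (-j).toNat, (hY.iLayer h _).i_mem j (by push_cast; lia) y
      (iLayer_mono (Nat.le_add_right _ _) hn)⟩
  · intro hj y hy
    obtain ⟨n, hn⟩ := mem_iSpan.1 hy
    exact mem_iSpan.2 ⟨n, (hY.iLayer h n).g_mem j hj y hn⟩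
  · intro hj y hy
    obtain ⟨n, hn⟩ := mem_iSpan.1 hy
    exact (hY.iLayer h n).i_zero j hj y hn
  · intro hj y hy
    obtain ⟨n, hn⟩ := mem_iSpan.1 hy
    exact (hY.iLayer h n).g_zero j hj y hn
  · intro hj hy
    obtain ⟨n, hn⟩ := mem_iSpan.1 hj
    exact (hY.iLayer h n).i_inj j hn hy

theorem IsSingular.mem_of_mem_iSpan (h : SatisfiesBrackets act) (hY : IsSingular act α β z Y)
    {x : M} (hx : x ∈ _root_.iSpan act α Y)
    (h0 : ∀ j : ℤ, (z : ℤ) + α < j → act (.l j) x = 0) : x ∈ Y := by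
  obtain ⟨n, hn⟩ := mem_iSpan.1 hx
  clear hx
  induction n with
  | zero => exact hn
  | succ n ih => exact ih ((hY.iLayer h n).mem_of_mem_orbit h hn (h0 _ (by push_cast; lia)))

/-- The subspace generated by `Y` under `G_{-(β+1)}`. -/
def gStep (act : SB → M →ₗ[ℂ] M) (β : ℕ) (Y : Submodule ℂ M) : Submodule ℂ M :=
  Y ⊔ Y.map (act (.g (-(β + 1 : ℤ))))

theorem mem_gStep {x : M} :
    x ∈ gStep act β Y ↔ ∃ y₀ ∈ Y, ∃ y₁ ∈ Y, y₀ + act (.g (-(β + 1 : ℤ))) y₁ = x := by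
  simp [gStep, Submodule.mem_sup]

theorem IsISingular.lower_g (h : SatisfiesBrackets act) (hY : IsISingular act β z Y)
    {y₀ y₁ : M} (hy₀ : y₀ ∈ Y) (hy₁ : y₁ ∈ Y) :
    act (.g (z + β + 1)) (y₀ + act (.g (-(β + 1 : ℤ))) y₁) = (2 : ℂ) • act (.i z) y₁ := by
  rw [map_add, h.gg, hY.g_zero _ (by lia) y₀ hy₀, hY.g_zero _ (by lia) y₁ hy₁, map_zero,
    neg_zero, zero_add, zero_add, show (z + β + 1 : ℤ) + -(β + 1 : ℤ) = z by ring]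

theorem IsISingular.mem_of_mem_gStep (h : SatisfiesBrackets act) (hY : IsISingular act β z Y)
    {x : M} (hx : x ∈ gStep act β Y) (h0 : act (.g (z + β + 1)) x = 0) : x ∈ Y := by
  obtain ⟨y₀, hy₀, y₁, hy₁, rfl⟩ := mem_gStep.1 hx
  rw [hY.lower_g h hy₀ hy₁, smul_eq_zero] at h0
  rw [hY.i_inj y₁ hy₁ (h0.resolve_left two_ne_zero), map_zero, add_zero]
  exact hy₀

theorem IsISingular.gStep (h : SatisfiesBrackets act) (hY : IsISingular act β z Y) :
    IsISingular act (β + 1) z (gStep act β Y) := by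
  have hg : ∀ j : ℤ, -((β + 1 : ℕ) : ℤ) ≤ j → ∀ y ∈ Y, act (.g j) y ∈ _root_.gStep act β Y := by
    intro j hj y hy
    rcases eq_or_lt_of_le hj with rfl | hj
    · refine mem_gStep.2 ⟨0, zero_mem _, y, hy, ?_⟩
      rw [zero_add]
      push_cast
      rfl
    · exact le_sup_left (a := Y) (hY.g_mem j (by push_cast at hj; lia) y hy)
  refine ⟨?_, ?_, ?_, ?_, ?_, ?_⟩ <;> intro j
  · rintro hj x hx
    obtain ⟨y₀, hy₀, y₁, hy₁, rfl⟩ := mem_gStep.1 hx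
    rw [map_add, h.lg]
    refine add_mem (le_sup_left (a := Y) (hY.l_mem j hj _ hy₀)) (add_mem ?_ ?_)
    · exact hg _ (by push_cast; lia) _ (hY.l_mem j hj _ hy₁)
    · exact Submodule.smul_mem _ _ (hg _ (by push_cast; lia) _ hy₁)
  · intro x hx
    obtain ⟨y₀, hy₀, y₁, hy₁, rfl⟩ := mem_gStep.1 hx
    rw [map_add, h.ig]
    exact add_mem (le_sup_left (a := Y) (hY.i_mem j _ hy₀))
      (hg _ (by push_cast; lia) _ (hY.i_mem j _ hy₁))
  · intro hj x hx
    obtain ⟨y₀, hy₀, y₁, hy₁, rfl⟩ := mem_gStep.1 hx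
    rw [map_add]
    refine add_mem (hg j hj _ hy₀) ?_
    rcases eq_or_lt_of_le hj with rfl | hj
    · have h2 : act (.g (-(β + 1 : ℤ))) (act (.g (-(β + 1 : ℤ))) y₁) =
          act (.i (-(β + 1 : ℤ) + -(β + 1 : ℤ))) y₁ := by
        have := h.gg (-(β + 1 : ℤ)) (-(β + 1 : ℤ)) y₁
        rw [eq_neg_add_iff_add_eq, ← two_smul ℂ] at this
        exact smul_right_injective M (two_ne_zero (α := ℂ)) this
      push_cast
      rw [h2]
      exact le_sup_left (a := Y) (hY.i_mem _ _ hy₁)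
    · rw [h.gg]
      refine add_mem (neg_mem (hg _ (by push_cast; lia) _ (hY.g_mem j ?_ _ hy₁)))
        (Submodule.smul_mem _ _ (le_sup_left (a := Y) (hY.i_mem _ _ hy₁)))
      push_cast at hj
      lia
  · intro hj x hx
    obtain ⟨y₀, hy₀, y₁, hy₁, rfl⟩ := mem_gStep.1 hx
    rw [map_add, h.ig, hY.i_zero j hj _ hy₀, hY.i_zero j hj _ hy₁, map_zero, add_zero]
  · intro hj x hx
    push_cast at hj
    obtain ⟨y₀, hy₀, y₁, hy₁, rfl⟩ := mem_gStep.1 hx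
    rw [map_add, h.gg, hY.g_zero j (by lia) _ hy₀, hY.g_zero j (by lia) _ hy₁, map_zero,
      hY.i_zero _ (by lia) _ hy₁]
    simp
  · intro hj hx0
    obtain ⟨y₀, hy₀, y₁, hy₁, rfl⟩ := mem_gStep.1 hj
    have h0 : act (.g (z + β + 1)) (act (.i z) (y₀ + act (.g (-(β + 1 : ℤ))) y₁)) = 0 := by
      rw [hx0, map_zero]
    rw [← h.ig, hY.lower_g h hy₀ hy₁, map_smul, smul_eq_zero] at h0
    have h1 : y₁ = 0 :=
      hY.i_inj y₁ hy₁ (hY.i_inj _ (hY.i_mem _ _ hy₁) (h0.resolve_left two_ne_zero))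
    subst h1
    rw [map_zero, add_zero] at hx0 ⊢
    exact hY.i_inj y₀ hy₀ hx0

/-- The subspace generated by `Y` under `G_j`, `j ≥ -(β + n)`. -/
def gLayer (act : SB → M →ₗ[ℂ] M) (β : ℕ) (Y : Submodule ℂ M) : ℕ → Submodule ℂ M
  | 0 => Y
  | n + 1 => gStep act (β + n) (gLayer act β Y n)

theorem gLayer_mono : Monotone (gLayer act β Y) :=
  monotone_nat_of_le_succ fun _ => le_sup_left

theorem IsISingular.gLayer (h : SatisfiesBrackets act) (hY : IsISingular act β z Y) (n : ℕ) :
    IsISingular act (β + n) z (gLayer act β Y n) := by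
  induction n with
  | zero => exact hY
  | succ n ih => exact ih.gStep h

/-- The subspace generated by `Y` under all `G_j`. -/
def gSpan (act : SB → M →ₗ[ℂ] M) (β : ℕ) (Y : Submodule ℂ M) : Submodule ℂ M :=
  ⨆ n, gLayer act β Y n

theorem mem_gSpan {x : M} : x ∈ gSpan act β Y ↔ ∃ n, x ∈ gLayer act β Y n :=
  Submodule.mem_iSup_of_directed _ gLayer_mono.directed_le

theorem IsISingular.gSpan (h : SatisfiesBrackets act) (hY : IsISingular act β z Y) :
    IsIGSingular act z (gSpan act β Y) := by
  refine ⟨?_, ?_, ?_, ?_, ?_⟩ <;> intro j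
  · intro hj y hy
    obtain ⟨n, hn⟩ := mem_gSpan.1 hy
    exact mem_gSpan.2 ⟨n, (hY.gLayer h n).l_mem j hj y hn⟩
  · intro y hy
    obtain ⟨n, hn⟩ := mem_gSpan.1 hy
    exact mem_gSpan.2 ⟨n, (hY.gLayer h n).i_mem j y hn⟩
  · intro y hy
    obtain ⟨n, hn⟩ := mem_gSpan.1 hy
    exact mem_gSpan.2 ⟨n + (-j).toNat, (hY.gLayer h _).g_mem j (by push_cast; lia) y
      (gLayer_mono (Nat.le_add_right _ _) hn)⟩
  · intro hj y hy
    obtain ⟨n, hn⟩ := mem_gSpan.1 hy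
    exact (hY.gLayer h n).i_zero j hj y hn
  · intro hj hy
    obtain ⟨n, hn⟩ := mem_gSpan.1 hj
    exact (hY.gLayer h n).i_inj j hn hy

theorem IsISingular.mem_of_mem_gSpan (h : SatisfiesBrackets act) (hY : IsISingular act β z Y)
    {x : M} (hx : x ∈ _root_.gSpan act β Y)
    (h0 : ∀ j : ℤ, (z : ℤ) + β < j → act (.g j) x = 0) : x ∈ Y := by
  obtain ⟨n, hn⟩ := mem_gSpan.1 hx
  clear hx
  induction n with
  | zero => exact hn
  | succ n ih => exact ih ((hY.gLayer h n).mem_of_mem_gStep h hn (h0 _ (by push_cast; lia)))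

end InducedLayers

section VirasoroLayers

variable {M : Type*} [AddCommGroup M] [Module ℂ M] {act : SB → M →ₗ[ℂ] M} {α β z : ℕ}
  {Y : Submodule ℂ M}

/-- The span of the products of fewer than `d` operators `L_{-(n+1)}` applied to `Y`. -/
def lLayer (act : SB → M →ₗ[ℂ] M) (Y : Submodule ℂ M) : ℕ → Submodule ℂ M
  | 0 => ⊥
  | d + 1 => Y ⊔ ⨆ n : ℕ, (lLayer act Y d).map (act (.l (-(n + 1 : ℤ))))

theorem le_lLayer_succ (d : ℕ) : Y ≤ lLayer act Y (d + 1) := le_sup_left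

theorem l_mem_lLayer_succ {d : ℕ} {x : M} (hx : x ∈ lLayer act Y d) (n : ℕ) :
    act (.l (-(n + 1 : ℤ))) x ∈ lLayer act Y (d + 1) :=
  le_sup_right (a := Y) (Submodule.mem_iSup_of_mem n (Submodule.mem_map_of_mem hx))

theorem lLayer_succ_le {d : ℕ} {U : Submodule ℂ M} (hY : Y ≤ U)
    (hU : ∀ n : ℕ, ∀ x ∈ lLayer act Y d, act (.l (-(n + 1 : ℤ))) x ∈ U) :
    lLayer act Y (d + 1) ≤ U :=
  sup_le hY (iSup_le fun n => Submodule.map_le_iff_le_comap.2 (hU n))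

theorem lLayer_one : lLayer act Y 1 = Y := by
  simp [lLayer]

theorem lLayer_mono : Monotone (lLayer act Y) := by
  refine monotone_nat_of_le_succ fun d => ?_
  induction d with
  | zero => exact bot_le
  | succ d ih => exact lLayer_succ_le (le_lLayer_succ _) fun n x hx => l_mem_lLayer_succ (ih hx) n

section

variable (h : SatisfiesBrackets act) (hY : IsIGSingular act z Y)
include h hY

theorem i_mem_lLayer (d : ℕ) (j : ℤ) {x : M} (hx : x ∈ lLayer act Y d) :
    act (.i j) x ∈ lLayer act Y d := by
  induction d generalizing j x with
  | zero =>
    have : x = 0 := by simpa [lLayer] using hx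
    simp [this]
  | succ d ih =>
    refine lLayer_succ_le (U := (lLayer act Y (d + 1)).comap (act (.i j)))
      (fun y hy => le_lLayer_succ d (hY.i_mem j y hy)) (fun n x hx => ?_) hx
    rw [Submodule.mem_comap, ← sub_eq_iff_eq_add.2 (h.li _ j x)]
    exact sub_mem (l_mem_lLayer_succ (ih j hx) n)
      (Submodule.smul_mem _ _ (lLayer_mono d.le_succ (ih _ hx)))

theorem g_mem_lLayer (d : ℕ) (j : ℤ) {x : M} (hx : x ∈ lLayer act Y d) :
    act (.g j) x ∈ lLayer act Y d := by
  induction d generalizing j x with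
  | zero =>
    have : x = 0 := by simpa [lLayer] using hx
    simp [this]
  | succ d ih =>
    refine lLayer_succ_le (U := (lLayer act Y (d + 1)).comap (act (.g j)))
      (fun y hy => le_lLayer_succ d (hY.g_mem j y hy)) (fun n x hx => ?_) hx
    rw [Submodule.mem_comap, ← sub_eq_iff_eq_add.2 (h.lg _ j x)]
    exact sub_mem (l_mem_lLayer_succ (ih j hx) n)
      (Submodule.smul_mem _ _ (lLayer_mono d.le_succ (ih _ hx)))

theorem i_mem_lLayer_of_lt (d : ℕ) {j : ℤ} (hj : (z : ℤ) < j) {x : M}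
    (hx : x ∈ lLayer act Y (d + 1)) : act (.i j) x ∈ lLayer act Y d := by
  induction d generalizing x with
  | zero =>
    rw [zero_add, lLayer_one] at hx
    rw [hY.i_zero j hj x hx]
    exact zero_mem _
  | succ d ih =>
    refine lLayer_succ_le (U := (lLayer act Y (d + 1)).comap (act (.i j)))
      (fun y hy => le_lLayer_succ d (hY.i_mem j y hy)) (fun n x hx => ?_) hx
    rw [Submodule.mem_comap, ← sub_eq_iff_eq_add.2 (h.li _ j x)]
    exact sub_mem (l_mem_lLayer_succ (ih hx) n)
      (Submodule.smul_mem _ _ (i_mem_lLayer h hY _ _ hx))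

theorem l_mem_lLayer_of_nonneg (d : ℕ) {j : ℤ} (hj : 0 ≤ j) {x : M}
    (hx : x ∈ lLayer act Y d) : act (.l j) x ∈ lLayer act Y d := by
  induction d generalizing j x with
  | zero =>
    have : x = 0 := by simpa [lLayer] using hx
    simp [this]
  | succ d ih =>
    refine lLayer_succ_le (U := (lLayer act Y (d + 1)).comap (act (.l j)))
      (fun y hy => le_lLayer_succ d (hY.l_mem j hj y hy)) (fun n x hx => ?_) hx
    rw [Submodule.mem_comap, h.ll]
    refine add_mem (l_mem_lLayer_succ (ih hj hx) n) (Submodule.smul_mem _ _ ?_)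
    by_cases hn : 0 ≤ j + -(n + 1 : ℤ)
    · exact lLayer_mono d.le_succ (ih hn hx)
    · obtain ⟨k, hk⟩ : ∃ k : ℕ, j + -(n + 1 : ℤ) = -(k + 1 : ℤ) :=
        ⟨(-(j + -(n + 1 : ℤ)) - 1).toNat, by lia⟩
      rw [hk]
      exact l_mem_lLayer_succ hx k

theorem l_mem_lLayer (d : ℕ) (j : ℤ) {x : M} (hx : x ∈ lLayer act Y d) :
    act (.l j) x ∈ lLayer act Y (d + 1) := by
  by_cases hj : 0 ≤ j
  · exact lLayer_mono d.le_succ (l_mem_lLayer_of_nonneg h hY d hj hx)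
  · obtain ⟨k, rfl⟩ : ∃ k : ℕ, j = -(k + 1 : ℤ) := ⟨(-j - 1).toNat, by lia⟩
    exact l_mem_lLayer_succ hx k

end

/-- The product of the operators `L_{-(n+1)}`, `n ∈ l`. -/
def lWord (act : SB → M →ₗ[ℂ] M) (l : List ℕ) : Module.End ℂ M :=
  (l.map fun n : ℕ => act (.l (-(n + 1 : ℤ)))).prod

/-- The product of the operators `I_{z+n+1}`, `n ∈ l`. -/
def iWord (act : SB → M →ₗ[ℂ] M) (z : ℕ) (l : List ℕ) : Module.End ℂ M :=
  (l.map fun n : ℕ => act (.i (z + n + 1 : ℤ))).prod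

theorem lWord_nil (x : M) : lWord act [] x = x := rfl

theorem lWord_cons (n : ℕ) (l : List ℕ) (x : M) :
    lWord act (n :: l) x = act (.l (-(n + 1 : ℤ))) (lWord act l x) := by
  simp [lWord]

theorem iWord_nil (x : M) : iWord act z [] x = x := rfl

theorem iWord_cons (n : ℕ) (l : List ℕ) (x : M) :
    iWord act z (n :: l) x = act (.i (z + n + 1 : ℤ)) (iWord act z l x) := by
  simp [iWord]

theorem lWord_mem_lLayer {y : M} (hy : y ∈ Y) (l : List ℕ) :
    lWord act l y ∈ lLayer act Y (l.length + 1) := by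
  induction l with
  | nil => exact le_lLayer_succ _ hy
  | cons n l ih =>
    rw [lWord_cons]
    exact l_mem_lLayer_succ ih n

theorem iWord_perm (h : SatisfiesBrackets act) {l l' : List ℕ} (hl : l.Perm l') (x : M) :
    iWord act z l x = iWord act z l' x := by
  induction hl with
  | nil => rfl
  | cons a _ ih => rw [iWord_cons, iWord_cons, ih]
  | swap a b l => rw [iWord_cons, iWord_cons, iWord_cons, iWord_cons, h.ii]
  | trans _ _ ih₁ ih₂ => exact ih₁.trans ih₂

theorem iWord_i (h : SatisfiesBrackets act) (l : List ℕ) (j : ℤ) (x : M) :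
    iWord act z l (act (.i j) x) = act (.i j) (iWord act z l x) := by
  induction l with
  | nil => rfl
  | cons n l ih => rw [iWord_cons, ih, h.ii, iWord_cons]

theorem iWord_eq_zero (h : SatisfiesBrackets act) {l : List ℕ} (hl : l ≠ []) {x : M}
    (hx : ∀ j : ℤ, (z : ℤ) < j → act (.i j) x = 0) : iWord act z l x = 0 := by
  cases l with
  | nil => exact absurd rfl hl
  | cons n l => rw [iWord_cons, ← iWord_i h, hx _ (by lia), map_zero]

/-- Commutator of a product of the `I_{z+n+1}` with `L_{-(i+1)}`. -/
theorem iWord_l (h : SatisfiesBrackets act) (l : List ℕ) (i : ℕ) (x : M) :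
    iWord act z l (act (.l (-(i + 1 : ℤ))) x) =
      act (.l (-(i + 1 : ℤ))) (iWord act z l x) +
        (l.map fun n : ℕ => (-(z + n + 1 : ℂ)) •
          act (.i (z + n - i : ℤ)) (iWord act z (l.erase n) x)).sum := by
  induction l with
  | nil => simp [iWord_nil]
  | cons n l ih =>
    have hcomm : ∀ w : M, act (.i (z + n + 1 : ℤ)) (act (.l (-(i + 1 : ℤ))) w) =
        act (.l (-(i + 1 : ℤ))) (act (.i (z + n + 1 : ℤ)) w) +
          (-(z + n + 1 : ℂ)) • act (.i (z + n - i : ℤ)) w := by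
      intro w
      rw [h.li, show (-(i + 1 : ℤ) + (z + n + 1) : ℤ) = z + n - i by ring]
      push_cast
      module
    rw [iWord_cons, ih, map_add, hcomm, iWord_cons, List.map_cons, List.sum_cons,
      List.erase_cons_head, add_assoc, map_list_sum, List.map_map]
    congr 3
    refine List.map_congr_left fun k hk => ?_
    have hp : (n :: l.erase k).Perm ((n :: l).erase k) := by
      by_cases hnk : n = k
      · subst hnk
        rw [List.erase_cons_head]
        exact (List.perm_cons_erase hk).symm
      · rw [List.erase_cons_tail (by simpa using hnk)]
    rw [Function.comp_apply, map_smul, h.ii, ← iWord_cons, iWord_perm h hp]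

section

variable (h : SatisfiesBrackets act) (hY : IsIGSingular act z Y)
include h hY

theorem lWord_sub_mem_of_perm {l l' : List ℕ} (hl : l.Perm l') {y : M} (hy : y ∈ Y) :
    lWord act l y - lWord act l' y ∈ lLayer act Y l.length := by
  induction hl with
  | nil => simp
  | cons a _ ih =>
    rw [lWord_cons, lWord_cons, ← map_sub]
    exact l_mem_lLayer_succ ih a
  | swap a b l =>
    rw [lWord_cons, lWord_cons, lWord_cons, lWord_cons, h.ll, add_sub_cancel_left]
    exact Submodule.smul_mem _ _ (l_mem_lLayer h hY _ _ (lWord_mem_lLayer hy l))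
  | trans h₁ _ ih₁ ih₂ =>
    rw [← sub_add_sub_cancel]
    refine add_mem ih₁ ?_
    rw [h₁.length_eq]
    exact ih₂

theorem iWord_mem_lLayer (l : List ℕ) (d : ℕ) {x : M} (hx : x ∈ lLayer act Y (l.length + d)) :
    iWord act z l x ∈ lLayer act Y d := by
  induction l generalizing d with
  | nil => simpa [iWord_nil] using hx
  | cons n l ih =>
    rw [iWord_cons]
    refine i_mem_lLayer_of_lt h hY d (by lia) (ih (d + 1) ?_)
    rwa [List.length_cons, add_assoc, add_comm 1 d] at hx

theorem iWord_eq_zero_of_mem_lLayer (l : List ℕ) {x : M} (hx : x ∈ lLayer act Y l.length) :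
    iWord act z l x = 0 := by
  simpa [lLayer] using iWord_mem_lLayer h hY l 0 hx

end

/-- The coefficient with which a product of operators `I_{z+n+1}` pairs with the
corresponding product of operators `L_{-(n+1)}`. -/
def pairCoeff (z : ℕ) : List ℕ → ℂ
  | [] => 1
  | i :: l => ((i :: l).count i : ℂ) * (-(z + i + 1 : ℂ) * pairCoeff z l)

theorem pairCoeff_ne_zero (z : ℕ) (l : List ℕ) : pairCoeff z l ≠ 0 := by
  induction l with
  | nil => exact one_ne_zero
  | cons i l ih =>
    refine mul_ne_zero ?_ (mul_ne_zero (neg_ne_zero.2 ?_) ih)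
    · rw [List.count_cons_self]
      exact Nat.cast_ne_zero.2 (Nat.succ_ne_zero _)
    · exact_mod_cast Nat.succ_ne_zero (z + i)

theorem List.sum_map_ite_eq_count_smul {ι : Type*} [DecidableEq ι] (l : List ι) (i : ι) (t : M) :
    (l.map fun n => if n = i then t else 0).sum = (l.count i : ℂ) • t := by
  induction l with
  | nil => simp
  | cons a l ih =>
    rw [List.map_cons, List.sum_cons, ih, List.count_cons]
    by_cases ha : a = i
    · simp [ha, add_smul, add_comm]
    · simp [ha]

section

variable (h : SatisfiesBrackets act) (hY : IsIGSingular act z Y)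
include h hY

theorem iWord_lWord {l l' : List ℕ} (hlen : l.length = l'.length) (hsum : l'.sum ≤ l.sum)
    {y : M} (hy : y ∈ Y) :
    iWord act z l (lWord act l' y) =
      if l.Perm l' then pairCoeff z l' • (act (.i z) ^ l'.length) y else 0 := by
  induction l' generalizing l with
  | nil =>
    obtain rfl : l = [] := List.eq_nil_of_length_eq_zero hlen
    simp [iWord_nil, lWord_nil, pairCoeff]
  | cons i l' ih =>
    have hw : lWord act l' y ∈ lLayer act Y l.length := by
      rw [hlen]
      exact lWord_mem_lLayer hy l'
    rw [lWord_cons, iWord_l h, iWord_eq_zero_of_mem_lLayer h hY l hw, map_zero, zero_add]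
    have hterm : ∀ n ∈ l, (-(z + n + 1 : ℂ)) •
          act (.i (z + n - i : ℤ)) (iWord act z (l.erase n) (lWord act l' y)) =
        if n = i then (if l.Perm (i :: l') then
          (-(z + i + 1 : ℂ) * pairCoeff z l') • (act (.i z) ^ (l'.length + 1)) y else 0)
        else 0 := by
      intro n hn
      have hlen' : (l.erase n).length + 1 = l.length := by
        rw [List.length_erase_of_mem hn]
        exact Nat.sub_add_cancel (List.length_pos_of_mem hn)
      have hsum' : l.sum = n + (l.erase n).sum := by
        rw [(List.perm_cons_erase hn).sum_eq, List.sum_cons]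
      rw [List.sum_cons] at hsum
      rw [List.length_cons] at hlen
      rcases lt_trichotomy n i with hni | rfl | hni
      · rw [if_neg hni.ne, ih (by lia) (by lia), if_neg, map_zero, smul_zero]
        intro hp
        have := hp.sum_eq
        lia
      · rw [if_pos rfl, ih (by lia) (by lia), add_sub_cancel_right]
        have hiff : (l.erase n).Perm l' ↔ l.Perm (n :: l') := by
          rw [List.perm_comm, List.perm_comm (l₁ := l), List.cons_perm_iff_perm_erase]
          exact ⟨fun hp => ⟨hn, hp⟩, fun hp => hp.2⟩
        simp only [hiff]
        split_ifs with hp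
        · rw [map_smul, smul_smul, pow_succ', Module.End.mul_apply]
        · rw [map_zero, smul_zero]
      · rw [if_neg hni.ne', hY.i_zero _ (by lia), smul_zero]
        rw [← lLayer_one (act := act) (Y := Y)]
        exact iWord_mem_lLayer h hY _ _ (by rwa [hlen'])
    rw [List.map_congr_left hterm, List.sum_map_ite_eq_count_smul]
    split_ifs with hp
    · rw [smul_smul, pairCoeff, hp.count_eq, List.length_cons]
    · rw [smul_zero]

theorem lLayer_succ_le_words (d : ℕ) :
    lLayer act Y (d + 1) ≤ lLayer act Y d ⊔
      ⨆ m : {m : Multiset ℕ // m.card = d}, Y.map (lWord act m.1.toList) := by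
  induction d with
  | zero =>
    rw [zero_add, lLayer_one]
    refine le_trans (fun y hy => ?_) le_sup_right
    refine Submodule.mem_iSup_of_mem ⟨0, rfl⟩ ⟨y, hy, ?_⟩
    simp [lWord_nil]
  | succ d ih =>
    refine lLayer_succ_le ((le_lLayer_succ d).trans le_sup_left) fun n x hx => ?_
    suffices hle : lLayer act Y (d + 1) ≤ (lLayer act Y (d + 1) ⊔
        ⨆ m : {m : Multiset ℕ // m.card = d + 1}, Y.map (lWord act m.1.toList)).comap
          (act (.l (-(n + 1 : ℤ)))) from hle hx
    refine ih.trans (sup_le (fun x hx => Submodule.mem_sup_left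
      (l_mem_lLayer_succ hx n)) (iSup_le ?_))
    rintro ⟨m, hm⟩ _ ⟨y, hy, rfl⟩
    rw [Submodule.mem_comap, ← lWord_cons]
    have hp : (n :: m.toList).Perm (n ::ₘ m).toList := by
      rw [← Multiset.coe_eq_coe, ← Multiset.cons_coe, Multiset.coe_toList, Multiset.coe_toList]
    rw [← sub_add_cancel (lWord act (n :: m.toList) y) (lWord act (n ::ₘ m).toList y)]
    refine Submodule.add_mem_sup ?_ (Submodule.mem_iSup_of_mem ⟨n ::ₘ m, by simp [hm]⟩ ⟨y, hy, rfl⟩)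
    have := lWord_sub_mem_of_perm h hY hp hy
    rwa [List.length_cons, Multiset.length_toList, hm] at this

/-- A vector of `lLayer (d + 2)` killed by all `I_j`, `j > z`, lies in `lLayer (d + 1)`. -/
theorem mem_lLayer_of_killed (d : ℕ) {x : M} (hx : x ∈ lLayer act Y (d + 2))
    (h0 : ∀ j : ℤ, (z : ℤ) < j → act (.i j) x = 0) : x ∈ lLayer act Y (d + 1) := by
  obtain ⟨e, he, w, hw, rfl⟩ := Submodule.mem_sup.1 (lLayer_succ_le_words h hY (d + 1) hx)
  obtain ⟨s, hs⟩ := Submodule.mem_iSup_iff_exists_finset.1 hw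
  clear hx hw
  induction s using Finset.induction_on_max_value
    (fun m : {m : Multiset ℕ // m.card = d + 1} => m.1.sum) generalizing e w with
  | empty =>
    have : w = 0 := by simpa using hs
    rw [this, add_zero]
    exact he
  | insert a s has hmax ih =>
    rw [Finset.iSup_insert] at hs
    obtain ⟨u, ⟨y, hy, rfl⟩, r, hr, rfl⟩ := Submodule.mem_sup.1 hs
    have hlen : a.1.toList.length = d + 1 := by rw [Multiset.length_toList, a.2]
    have hr0 : iWord act z a.1.toList r = 0 := by
      have hle : (⨆ m ∈ s, Y.map (lWord act m.1.toList)) ≤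
          LinearMap.ker (iWord act z a.1.toList) := by
        refine iSup₂_le fun m hm => ?_
        rintro _ ⟨y', hy', rfl⟩
        rw [LinearMap.mem_ker, iWord_lWord h hY _ _ hy', if_neg]
        · intro hp
          rw [← Multiset.coe_eq_coe, Multiset.coe_toList, Multiset.coe_toList] at hp
          exact has (Subtype.ext hp ▸ hm)
        · rw [Multiset.length_toList, Multiset.length_toList, a.2, m.2]
        · rw [Multiset.sum_toList, Multiset.sum_toList]
          exact hmax m hm
      exact hle hr
    have hkill := iWord_eq_zero h (l := a.1.toList) (by
      intro hnil
      simp [hnil] at hlen) h0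
    rw [map_add, iWord_eq_zero_of_mem_lLayer h hY _ (by rwa [hlen]), zero_add, map_add, hr0,
      add_zero, iWord_lWord h hY rfl le_rfl hy, if_pos (List.Perm.refl _), smul_eq_zero] at hkill
    have hy0 : y = 0 := eq_zero_of_stable_pow_eq_zero (hY.i_mem z) hY.i_inj hy
      (hkill.resolve_left (pairCoeff_ne_zero _ _))
    subst hy0
    rw [map_zero, zero_add] at h0 ⊢
    exact ih e he r h0 hr

end

/-- The subspace generated by `Y` under all `L_j`. -/
def lSpan (act : SB → M →ₗ[ℂ] M) (Y : Submodule ℂ M) : Submodule ℂ M := ⨆ d, lLayer act Y d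

theorem mem_lSpan {x : M} : x ∈ lSpan act Y ↔ ∃ d, x ∈ lLayer act Y d :=
  Submodule.mem_iSup_of_directed _ lLayer_mono.directed_le

theorem IsIGSingular.isStable_lSpan (h : SatisfiesBrackets act) (hY : IsIGSingular act z Y) :
    IsStable act (lSpan act Y) := by
  intro a x hx
  obtain ⟨d, hd⟩ := mem_lSpan.1 hx
  cases a with
  | l j => exact mem_lSpan.2 ⟨d + 1, l_mem_lLayer h hY d j hd⟩
  | i j => exact mem_lSpan.2 ⟨d, i_mem_lLayer h hY d j hd⟩
  | g j => exact mem_lSpan.2 ⟨d, g_mem_lLayer h hY d j hd⟩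

theorem IsIGSingular.mem_of_mem_lSpan (h : SatisfiesBrackets act) (hY : IsIGSingular act z Y)
    {x : M} (hx : x ∈ lSpan act Y) (h0 : ∀ j : ℤ, (z : ℤ) < j → act (.i j) x = 0) : x ∈ Y := by
  obtain ⟨d, hd⟩ := mem_lSpan.1 hx
  clear hx
  rw [← lLayer_one (act := act) (Y := Y)]
  induction d with
  | zero => exact lLayer_mono zero_le_one hd
  | succ d ih =>
    cases d with
    | zero => exact hd
    | succ d => exact ih (mem_lLayer_of_killed h hY d hd h0)

/-- The basis elements `L_j` (`j > z + α`), `I_j` (`j > z`) and `G_j` (`j > z + β`). -/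
def singularSet (α β z : ℕ) : Set SB := fun a =>
  match a with
  | .l m => (z : ℤ) + α < m
  | .i m => (z : ℤ) < m
  | .g m => (z : ℤ) + β < m

theorem one_le_deg_of_mem_singularSet {a : SB} (ha : a ∈ singularSet α β z) : 1 ≤ a.deg := by
  cases a with
  | l m =>
    have : (z : ℤ) + α < m := ha
    change 1 ≤ m
    lia
  | i m =>
    have : (z : ℤ) < m := ha
    change 1 ≤ m
    lia
  | g m =>
    have : (z : ℤ) + β < m := ha
    change 1 ≤ m
    lia

theorem mem_singularSet_of_le_deg {a : SB} (ha : (z + α + β + 1 : ℤ) ≤ a.deg) :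
    a ∈ singularSet α β z := by
  cases a with
  | l m =>
    change (z + α + β + 1 : ℤ) ≤ m at ha
    change (z : ℤ) + α < m
    lia
  | i m =>
    change (z + α + β + 1 : ℤ) ≤ m at ha
    change (z : ℤ) < m
    lia
  | g m =>
    change (z + α + β + 1 : ℤ) ≤ m at ha
    change (z : ℤ) + β < m
    lia

theorem IsSingular.act_eq_zero (hY : IsSingular act α β z Y) {a : SB}
    (ha : a ∈ singularSet α β z) {y : M} (hy : y ∈ Y) : act a y = 0 := by
  cases a with
  | l j => exact hY.l_zero j ha y hy
  | i j => exact hY.i_zero j ha y hy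
  | g j => exact hY.g_zero j ha y hy

/-- A singular subspace `Y` is contained in a stable subspace, with a nilpotent action of the
singular set, all of whose vectors killed by the singular set lie in `Y`. -/
theorem IsSingular.exists_stable (h : SatisfiesBrackets act) (hY : IsSingular act α β z Y) :
    ∃ Γ : Submodule ℂ M, Y ≤ Γ ∧ IsStable act Γ ∧ Γ ≤ nilPart act (singularSet α β z) ∧
      ∀ x ∈ Γ, (∀ a ∈ singularSet α β z, act a x = 0) → x ∈ Y := by
  have hI := hY.iSpan h
  have hG := hI.gSpan h
  refine ⟨lSpan act (gSpan act β (_root_.iSpan act α Y)) ⊓ nilPart act (singularSet α β z),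
    le_inf (fun y hy => ?_) fun y hy => ?_, fun a x hx => ?_, inf_le_right, fun x hx h0 => ?_⟩
  · exact mem_lSpan.2 ⟨1, le_lLayer_succ 0 (mem_gSpan.2 ⟨0, mem_iSpan.2 ⟨0, hy⟩⟩)⟩
  · refine mem_nilPart.2 ⟨1, mem_nilLayer_succ.2 fun a ha => ?_⟩
    rw [hY.act_eq_zero ha hy]
    exact zero_mem _
  · exact ⟨hG.isStable_lSpan h a x hx.1, isStable_nilPart h
      (fun a ha => one_le_deg_of_mem_singularSet ha)
      (fun a ha => mem_singularSet_of_le_deg ha) a x hx.2⟩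
  · exact hY.mem_of_mem_iSpan h (hI.mem_of_mem_gSpan h (hG.mem_of_mem_lSpan h hx.1
      fun j hj => h0 (.i j) hj) fun j hj => h0 (.g j) hj) fun j hj => h0 (.l j) hj

end VirasoroLayers

section EventualVanishing

open Polynomial

variable {M : Type*} [AddCommGroup M] [Module ℂ M]

theorem exists_X_pow_mul_eq_zero {φ : ℂ[X] →ₗ[ℂ] M} {m : ℕ}
    (hD : ∀ h : ℂ[X], (∀ g, φ (h * g) = 0) → φ (X ^ m * derivative h) = 0)
    {f : ℂ[X]} (hf : f ≠ 0) (h0 : ∀ g, φ (f * g) = 0) : ∃ N : ℕ, ∀ g, φ (X ^ N * g) = 0 := by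
  have hstep : ∀ h : ℂ[X], (∀ g, φ (h * g) = 0) → ∀ g, φ (X ^ m * derivative h * g) = 0 := by
    intro h hh g
    have h1 := hD (h * g) fun g' => by rw [mul_assoc]; exact hh _
    have h2 := hh (X ^ m * derivative g)
    rw [← h1, ← add_zero (φ _), ← h2, ← map_add]
    congr 1
    rw [derivative_mul]
    ring
  suffices H : ∀ d n : ℕ, ∀ r : ℂ[X], r ≠ 0 → r.natDegree ≤ d →
      (∀ g, φ (X ^ n * r * g) = 0) → ∃ N : ℕ, ∀ g, φ (X ^ N * g) = 0 from
    H _ 0 f hf le_rfl (by simpa using h0)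
  intro d
  induction d with
  | zero =>
    intro n r hr hd hz
    obtain ⟨c, rfl⟩ := natDegree_eq_zero.1 (Nat.le_zero.1 hd)
    have hc : c ≠ 0 := by simpa using hr
    refine ⟨n, fun g => ?_⟩
    have := hz (C c⁻¹ * g)
    rwa [mul_assoc, ← mul_assoc (C c), ← C_mul, mul_inv_cancel₀ hc, C_1, one_mul] at this
  | succ d ih =>
    intro n r hr hd hz
    rcases Nat.eq_zero_or_pos r.natDegree with h' | h'
    · exact ih n r hr (by omega) hz
    · refine ih (n + m + 1) (derivative r) ?_ ?_ fun g => ?_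
      · intro hr'
        have := derivative_eq_zero.1 hr'
        omega
      · have := natDegree_derivative_lt h'.ne'
        omega
      · have h1 := hstep _ hz (X * g)
        have h2 := hz (C (n : ℂ) * X ^ m * g)
        rw [← h1, ← sub_zero (φ (X ^ m * _ * _)), ← h2, ← map_sub]
        congr 1
        rw [derivative_mul, derivative_X_pow]
        cases n with
        | zero => simp; ring
        | succ n => simp; ring

theorem exists_derivative_eq (h : ℂ[X]) : ∃ H : ℂ[X], derivative H = h := by
  induction h using Polynomial.induction_on' with
  | add p q hp hq =>
    obtain ⟨P, rfl⟩ := hp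
    obtain ⟨Q, rfl⟩ := hq
    exact ⟨P + Q, derivative_add⟩
  | monomial n a =>
    refine ⟨monomial (n + 1) (a / (n + 1)), ?_⟩
    rw [derivative_monomial, Nat.add_sub_cancel]
    congr 1
    have : (n + 1 : ℂ) ≠ 0 := by exact_mod_cast n.succ_ne_zero
    push_cast
    field_simp

/-- A family linked by a locally finite operator through `T x_i = μ x_i + c_i x_{i + s}`, `c_i ≠ 0`,
spans a finite-dimensional space. -/
theorem exists_finiteDimensional_mem {W : Type} [AddCommGroup W] [Module ℂ W] {T : W →ₗ[ℂ] W}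
    (hT : LocFin T) {x : ℕ → W} {s : ℕ} (hs : 0 < s) {μ : ℂ} {c : ℕ → ℂ} (hc : ∀ i, c i ≠ 0)
    (hx : ∀ i, T (x i) = μ • x i + c i • x (i + s)) :
    ∃ F : Submodule ℂ W, FiniteDimensional ℂ F ∧ ∀ i, x i ∈ F := by
  set S : ℕ → Submodule ℂ W := fun i => Submodule.span ℂ (Set.range fun n : ℕ => (T ^ n) (x i))
  have hS : ∀ i, FiniteDimensional ℂ (S i) := fun i => hT (x i)
  refine ⟨⨆ i : Fin s, S i, inferInstance, fun i => ?_⟩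
  have hstable : ∀ w ∈ ⨆ i : Fin s, S i, T w ∈ ⨆ i : Fin s, S i := by
    suffices h : (⨆ i : Fin s, S i) ≤ (⨆ i : Fin s, S i).comap T from h
    refine iSup_le fun i => (Submodule.span_le.2 ?_)
    rintro _ ⟨n, rfl⟩
    refine Submodule.mem_iSup_of_mem i (Submodule.subset_span ⟨n + 1, ?_⟩)
    simp only [pow_succ', Module.End.mul_apply]
  induction i using Nat.strong_induction_on with
  | _ i ih =>
    rcases lt_or_ge i s with hi | hi
    · exact Submodule.mem_iSup_of_mem (⟨i, hi⟩ : Fin s) (Submodule.subset_span ⟨0, rfl⟩)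
    · have hm := ih (i - s) (by omega)
      have h1 : x i = (c (i - s))⁻¹ • (T (x (i - s)) - μ • x (i - s)) := by
        rw [hx, add_sub_cancel_left, smul_smul, inv_mul_cancel₀ (hc _), one_smul,
          Nat.sub_add_cancel hi]
      rw [h1]
      exact Submodule.smul_mem _ _
        (Submodule.sub_mem _ (hstable _ hm) (Submodule.smul_mem _ _ hm))

/-- The linear map from polynomials sending `X ^ j` to `x j`. -/
noncomputable def polyMap (x : ℕ → M) : ℂ[X] →ₗ[ℂ] M :=
  (Polynomial.basisMonomials ℂ).constr ℂ x

theorem polyMap_X_pow (x : ℕ → M) (n : ℕ) : polyMap x (X ^ n) = x n := by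
  have := (Polynomial.basisMonomials ℂ).constr_basis ℂ x n
  simpa only [polyMap, coe_basisMonomials, monomial_one_right_eq_X_pow] using this

theorem polyMap_hom_ext {f g : ℂ[X] →ₗ[ℂ] M} (h : ∀ n : ℕ, f (X ^ n) = g (X ^ n)) : f = g := by
  refine (Polynomial.basisMonomials ℂ).ext fun n => ?_
  simpa only [coe_basisMonomials, monomial_one_right_eq_X_pow] using h n

theorem finiteDimensional_range_polyMap {x : ℕ → M} {F : Submodule ℂ M} [FiniteDimensional ℂ F]
    (hx : ∀ i, x i ∈ F) : FiniteDimensional ℂ (LinearMap.range (polyMap x)) := by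
  refine Submodule.finiteDimensional_of_le (S₂ := F) ?_
  rw [polyMap, Module.Basis.constr_range, Submodule.span_le]
  rintro _ ⟨i, rfl⟩
  exact hx i

theorem exists_ne_zero_of_finiteDimensional {N : Type*} [AddCommGroup N] [Module ℂ N]
    [FiniteDimensional ℂ N] (Θ : ℂ[X] →ₗ[ℂ] N) : ∃ f : ℂ[X], f ≠ 0 ∧ Θ f = 0 := by
  by_contra! H
  have hinj : Function.Injective Θ := by
    rw [← LinearMap.ker_eq_bot, Submodule.eq_bot_iff]
    intro f hf
    by_contra h0
    exact H f h0 hf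
  exact Polynomial.not_finite (R := ℂ) (Module.Finite.of_injective Θ hinj)

theorem polyMap_apply (A : ℕ → M →ₗ[ℂ] M) (v : M) (f : ℂ[X]) :
    polyMap A f v = polyMap (fun j => A j v) f := by
  have : (LinearMap.applyₗ v).comp (polyMap A) = polyMap (fun j => A j v) :=
    polyMap_hom_ext fun n => by simp [polyMap_X_pow]
  exact LinearMap.congr_fun this f

theorem apply_polyMap {T : M →ₗ[ℂ] M} {x : ℕ → M} {s : ℕ} {μ c : ℂ}
    (hx : ∀ j : ℕ, T (x j) = μ • x j + (j + c) • x (j + s)) (f : ℂ[X]) :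
    T (polyMap x f) = μ • polyMap x f + polyMap x (X ^ s * (C c * f + X * derivative f)) := by
  induction f using Polynomial.induction_on' with
  | add p q hp hq =>
    simp only [map_add, mul_add, hp, hq, smul_add]
    abel
  | monomial n a =>
    have h1 : X ^ s * (C c * monomial n a + X * derivative (monomial n a)) =
        (a * (n + c)) • (X ^ (n + s) : ℂ[X]) := by
      rw [derivative_monomial, ← C_mul_X_pow_eq_monomial, ← C_mul_X_pow_eq_monomial, smul_eq_C_mul]
      cases n with
      | zero => simp; ring
      | succ n => simp; ring
    rw [h1, ← smul_X_eq_monomial, map_smul, map_smul, map_smul, polyMap_X_pow, polyMap_X_pow, hx,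
      smul_add, smul_smul, smul_smul, smul_smul, mul_comm a μ]

variable {act : SB → M →ₗ[ℂ] M}

theorem polyMap_l_comm (h : SatisfiesBrackets act) (s : ℕ) (f g : ℂ[X]) (v : M) :
    polyMap (fun j => act (.l (j + s + 1))) f (polyMap (fun j => act (.l (j + s + 1))) g v) =
      polyMap (fun j => act (.l (j + s + 1))) g (polyMap (fun j => act (.l (j + s + 1))) f v) +
      polyMap (fun j => act (.l (j + s + 1))) (X ^ (s + 2) * wronskian f g) v := by
  set Λ := polyMap fun j : ℕ => act (.l (j + s + 1)) with hΛ
  induction f using Polynomial.induction_on' with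
  | add p q hp hq =>
    simp only [map_add, mul_add, hp, hq, wronskian_add_left, LinearMap.add_apply]
    abel
  | monomial n a =>
    induction g using Polynomial.induction_on' with
    | add p q hp hq =>
      simp only [map_add, mul_add, hp, hq, wronskian_add_right, LinearMap.add_apply]
      abel
    | monomial m b =>
      have h1 : X ^ (s + 2) * wronskian (monomial n a) (monomial m b) =
          (a * b * (m - n)) • (X ^ (n + m + s + 1) : ℂ[X]) := by
        rw [wronskian, derivative_monomial, derivative_monomial]
        simp only [← C_mul_X_pow_eq_monomial, smul_eq_C_mul]
        cases n with
        | zero =>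
          cases m with
          | zero => simp
          | succ m => simp; ring
        | succ n =>
          cases m with
          | zero => simp; ring
          | succ m => simp; ring
      rw [h1, ← smul_X_eq_monomial, ← smul_X_eq_monomial]
      simp only [map_smul, LinearMap.smul_apply, hΛ, polyMap_X_pow]
      rw [h.ll]
      have h2 : ((n : ℤ) + s + 1 + (m + s + 1)) = ((n + m + s + 1 : ℕ) : ℤ) + s + 1 := by
        push_cast
        ring
      rw [h2, smul_add, smul_add, smul_smul, smul_smul, smul_smul, smul_smul, mul_comm b a]
      congr 2
      push_cast
      ring

theorem eventually_zero_of_polyMap {x : ℤ → M} {s N : ℕ}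
    (hN : ∀ g : ℂ[X], polyMap (fun j : ℕ => x (j + s + 1)) (X ^ N * g) = 0) :
    ∃ K : ℕ, ∀ j : ℤ, (K : ℤ) ≤ j → x j = 0 := by
  refine ⟨N + s + 1, fun j hj => ?_⟩
  obtain ⟨i, rfl⟩ := Int.le.dest hj
  have := hN (X ^ i)
  rw [← pow_add, polyMap_X_pow] at this
  rw [← this]
  congr 1
  push_cast
  ring

theorem map_derivative_eq_zero {T : M →ₗ[ℂ] M} {x : ℕ → M} {s : ℕ} {μ c : ℂ}
    (hx : ∀ j : ℕ, T (x j) = μ • x j + (j + c) • x (j + s)) {f : ℂ[X]}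
    (hf : ∀ g, polyMap x (f * g) = 0) : polyMap x (X ^ (s + 1) * derivative f) = 0 := by
  have h0 : polyMap x f = 0 := by simpa using hf 1
  have h1 : polyMap x (X ^ s * (C c * f)) = 0 := by
    rw [show X ^ s * (C c * f) = f * (X ^ s * C c) by ring]
    exact hf _
  have h2 := apply_polyMap hx f
  rw [h0, map_zero, smul_zero, zero_add, mul_add, map_add, h1, zero_add] at h2
  rw [h2]
  congr 1
  ring

section

variable {W : Type} [AddCommGroup W] [Module ℂ W] {act : SB → W →ₗ[ℂ] W}

/-- An eigenvector of a locally finite `L_s` is killed by all `L_j` with `j` large. -/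
theorem exists_l_eq_zero (h : SatisfiesBrackets act) {s : ℕ} (hs : 0 < s)
    (hfin : LocFin (act (.l s))) {v : W} {μ : ℂ} (hv : act (.l s) v = μ • v) :
    ∃ K : ℕ, ∀ j : ℤ, (K : ℤ) ≤ j → act (.l j) v = 0 := by
  have hx : ∀ j : ℕ, act (.l s) (act (.l (j + s + 1)) v) = μ • act (.l (j + s + 1)) v +
      (j + 1 : ℂ) • act (.l ((j + s : ℕ) + s + 1)) v := by
    intro j
    rw [h.ll, hv, map_smul]
    have h2 : ((s : ℤ) + (j + s + 1)) = ((j + s : ℕ) : ℤ) + s + 1 := by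
      push_cast
      ring
    rw [h2]
    congr 2
    push_cast
    ring
  obtain ⟨F, hF, hFx⟩ := exists_finiteDimensional_mem hfin hs
    (fun j => by exact_mod_cast j.succ_ne_zero) hx
  set x : ℕ → W := fun j => act (.l (j + s + 1)) v with hxdef
  set Λ := polyMap fun j : ℕ => act (.l (j + s + 1)) with hΛ
  have hφ : ∀ f, Λ f v = polyMap x f := fun f => polyMap_apply _ v f
  have hR : FiniteDimensional ℂ (LinearMap.range (polyMap x)) :=
    finiteDimensional_range_polyMap hFx
  let b := Module.finBasis ℂ (LinearMap.range (polyMap x))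
  choose g hg using fun i => (b i).2
  let π := (polyMap x).rangeRestrict
  obtain ⟨f, hf, hΘ⟩ := exists_ne_zero_of_finiteDimensional (π.prod (LinearMap.pi fun i =>
    π ∘ₗ LinearMap.mulLeft ℂ (X ^ (s + 2)) ∘ₗ (wronskianBilin ℂ).flip (g i)))
  have hf0 : polyMap x f = 0 := congrArg (fun t => (t.1 : W)) hΘ
  have hfg : ∀ i, polyMap x (X ^ (s + 2) * wronskian f (g i)) = 0 := fun i =>
    congrArg (fun t => (t.2 i : W)) hΘ
  have hkill : Λ f ∘ₗ (LinearMap.range (polyMap x)).subtype = 0 := by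
    refine b.ext fun i => ?_
    have := polyMap_l_comm h s f (g i) v
    rw [← hΛ, hφ, hφ, hφ, hf0, map_zero, zero_add, hfg, hg] at this
    exact this
  have hw : ∀ q, polyMap x (X ^ (s + 2) * wronskian f q) = 0 := by
    intro q
    have h1 := polyMap_l_comm h s f q v
    rw [← hΛ, hφ, hφ, hφ, hf0, map_zero, zero_add] at h1
    rw [← h1]
    exact LinearMap.congr_fun hkill ⟨_, LinearMap.mem_range_self _ q⟩
  have hf2 : ∀ q, polyMap x (X ^ (s + 2) * f ^ 2 * q) = 0 := by
    intro q
    obtain ⟨H, rfl⟩ := exists_derivative_eq q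
    have h1 : X ^ (s + 2) * f ^ 2 * derivative H = X ^ (s + 2) * wronskian f (f * H) := by
      rw [wronskian, derivative_mul]
      ring
    rw [h1, hw]
  obtain ⟨N, hN⟩ := exists_X_pow_mul_eq_zero (fun f hf => map_derivative_eq_zero hx hf)
    (f := X ^ (s + 2) * f ^ 2) (mul_ne_zero (pow_ne_zero _ X_ne_zero) (pow_ne_zero _ hf)) hf2
  exact eventually_zero_of_polyMap (x := fun j => act (.l j) v) hN

/-- Let `v` be an eigenvector of a locally finite `L_s` killed by `L_j` for `j` large, and let
`X_n` be a family of operators with `[L_m, X_n] = n X_{m + n}`. Then `X_j v = 0` for `j` large. -/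
theorem exists_eq_zero_of_l_comm {A : ℤ → W →ₗ[ℂ] W}
    (hA : ∀ (m n : ℤ) (w : W), act (.l m) (A n w) = A n (act (.l m) w) + (n : ℂ) • A (m + n) w)
    {s : ℕ} (hs : 0 < s) (hfin : LocFin (act (.l s))) {v : W} {μ : ℂ}
    (hv : act (.l s) v = μ • v) {k : ℕ} (hk : ∀ j : ℤ, (k : ℤ) ≤ j → act (.l j) v = 0) :
    ∃ K : ℕ, ∀ j : ℤ, (K : ℤ) ≤ j → A j v = 0 := by
  have hgen : ∀ (i : ℕ) (ν : ℂ), act (.l i) v = ν • v → ∀ j : ℕ,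
      act (.l i) (A (j + s + 1) v) = ν • A (j + s + 1) v +
        (j + (s + 1) : ℂ) • A ((j + i : ℕ) + s + 1) v := by
    intro i ν hi j
    rw [hA, hi, map_smul]
    have h2 : ((i : ℤ) + (j + s + 1)) = ((j + i : ℕ) : ℤ) + s + 1 := by
      push_cast
      ring
    rw [h2]
    congr 2
    push_cast
    ring
  obtain ⟨F, hF, hFx⟩ := exists_finiteDimensional_mem hfin hs
    (fun j => by exact_mod_cast (j + s).succ_ne_zero) (hgen s μ hv)
  set x : ℕ → W := fun j => A (j + s + 1) v with hxdef
  have hR : FiniteDimensional ℂ (LinearMap.range (polyMap x)) :=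
    finiteDimensional_range_polyMap hFx
  obtain ⟨f, hf, hΘ⟩ := exists_ne_zero_of_finiteDimensional (polyMap x).rangeRestrict
  have hf0 : polyMap x f = 0 := congrArg Subtype.val hΘ
  have hmul : ∀ i : ℕ, k ≤ i → polyMap x (X ^ i * (C (s + 1 : ℂ) * f + X * derivative f)) = 0 := by
    intro i hi
    have := apply_polyMap (hgen i 0 (by rw [hk i (by exact_mod_cast hi), zero_smul])) f
    rw [← hxdef, hf0, map_zero, smul_zero, zero_add] at this
    exact this.symm
  obtain ⟨N, hN⟩ := exists_X_pow_mul_eq_zero (fun f hf => map_derivative_eq_zero (hgen s μ hv) hf)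
    (f := X ^ k * (C (s + 1 : ℂ) * f + X * derivative f))
    (mul_ne_zero (pow_ne_zero _ X_ne_zero) (by
      intro h0
      have h1 := congrArg (fun p => p.coeff f.natDegree) h0
      have h2 : (X * derivative f).coeff f.natDegree = f.natDegree * f.leadingCoeff := by
        cases hd : f.natDegree with
        | zero => simp
        | succ d =>
          rw [coeff_X_mul, coeff_derivative, leadingCoeff, hd]
          push_cast
          ring
      simp only [coeff_add, coeff_C_mul, h2, coeff_zero] at h1
      rw [coeff_natDegree, ← add_mul] at h1
      rcases mul_eq_zero.1 h1 with h3 | h3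
      · exact (s + f.natDegree).succ_ne_zero (by
          have : ((s + f.natDegree + 1 : ℕ) : ℂ) = 0 := by
            rw [← h3]
            push_cast
            ring
          exact_mod_cast this)
      · exact hf (leadingCoeff_eq_zero.1 h3))) (by
      intro q
      induction q using Polynomial.induction_on' with
      | add p q hp hq => rw [mul_add, map_add, hp, hq, add_zero]
      | monomial n a =>
        rw [← smul_X_eq_monomial, mul_smul_comm, map_smul, mul_right_comm, ← pow_add,
          hmul _ (Nat.le_add_right k n), smul_zero])
  exact eventually_zero_of_polyMap (x := fun j => A j v) hN

theorem exists_eigenvector_of_locFin {T : W →ₗ[ℂ] W} (hT : LocFin T) {w : W} (hw : w ≠ 0) :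
    ∃ v : W, v ≠ 0 ∧ ∃ μ : ℂ, T v = μ • v := by
  set S := Submodule.span ℂ (Set.range fun n : ℕ => (T ^ n) w) with hS
  have hfin : FiniteDimensional ℂ S := hT w
  have hwS : w ∈ S := Submodule.subset_span ⟨0, rfl⟩
  have hST : ∀ u ∈ S, T u ∈ S := by
    suffices h : S ≤ S.comap T from h
    refine Submodule.span_le.2 ?_
    rintro _ ⟨n, rfl⟩
    refine Submodule.subset_span ⟨n + 1, ?_⟩
    simp only [pow_succ', Module.End.mul_apply]
  have : Nontrivial S := ⟨⟨w, hwS⟩, 0, fun h => hw (congrArg Subtype.val h)⟩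
  obtain ⟨μ, hμ⟩ := Module.End.exists_eigenvalue (T.restrict hST)
  obtain ⟨v, hv⟩ := hμ.exists_hasEigenvector
  refine ⟨v, fun h => hv.2 (Subtype.ext h), μ, ?_⟩
  exact congrArg Subtype.val hv.apply_eq_smul

/-- If the `L_i` with `i ≥ z` act locally finitely, some nonzero vector is killed by all basis
elements of large degree. -/
theorem exists_ne_zero_mem_restrictedPart (h : SatisfiesBrackets act) {z : ℕ}
    (hfin : ∀ i : ℤ, (z : ℤ) ≤ i → LocFin (act (.l i))) {w : W} (hw : w ≠ 0) :
    ∃ v ∈ restrictedPart act, v ≠ 0 := by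
  have hz : LocFin (act (.l (z + 1 : ℕ))) := hfin _ (by push_cast; lia)
  obtain ⟨v, hv0, μ, hv⟩ := exists_eigenvector_of_locFin hz hw
  obtain ⟨a, ha⟩ := exists_l_eq_zero h z.succ_pos hz hv
  obtain ⟨b, hb⟩ := exists_eq_zero_of_l_comm h.li z.succ_pos hz hv ha
  obtain ⟨c, hc⟩ := exists_eq_zero_of_l_comm h.lg z.succ_pos hz hv ha
  refine ⟨v, mem_restrictedPart.2 ⟨a + b + c, fun x hx => ?_⟩, hv0⟩
  push_cast at hx
  cases x with
  | l j => exact ha j (by change _ ≤ j at hx; lia)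
  | i j => exact hb j (by change _ ≤ j at hx; lia)
  | g j => exact hc j (by change _ ≤ j at hx; lia)

end

end EventualVanishing

section Graded

theorem ZMod.two_cases (p : ZMod 2) : p = 0 ∨ p = 1 := by
  revert p
  decide

namespace GRep

variable {Q : Set SB} (ρ : GRep Q)

theorem eq_zero_of_add_eq_zero {p : ZMod 2} {u w : ρ.V} (hu : u ∈ ρ.grade p)
    (hw : w ∈ ρ.grade (p + 1)) (h : u + w = 0) : u = 0 ∧ w = 0 := by
  have hu' : u = -w := eq_neg_of_add_eq_zero_left h
  have hinf : u ∈ ρ.grade p ⊓ ρ.grade (p + 1) := ⟨hu, hu' ▸ neg_mem hw⟩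
  have hbot : ρ.grade p ⊓ ρ.grade (p + 1) = ⊥ := by
    rcases ZMod.two_cases p with rfl | rfl
    · exact ρ.grade_inf
    · rw [inf_comm]
      exact ρ.grade_inf
  rw [hbot, Submodule.mem_bot] at hinf
  exact ⟨hinf, by simpa [hinf] using h⟩

theorem act_eq_zero_of_add {a : SB} (ha : a ∈ Q) {v0 v1 : ρ.V} (h0 : v0 ∈ ρ.grade 0)
    (h1 : v1 ∈ ρ.grade 1) (h : ρ.act a (v0 + v1) = 0) : ρ.act a v0 = 0 ∧ ρ.act a v1 = 0 := by
  rw [map_add] at h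
  refine ρ.eq_zero_of_add_eq_zero (ρ.act_grade a ha 0 v0 h0) ?_ h
  rw [add_zero]
  exact ρ.act_grade a ha 1 v1 h1

theorem satisfiesBrackets (P : GRep (Set.univ : Set SB)) : SatisfiesBrackets P.act :=
  fun a b v => P.act_br a trivial b trivial v

variable {P : GRep (Set.univ : Set SB)}

/-- The sum of the homogeneous parts `U p ⊓ P.grade p` is a graded submodule when `U` is compatible
with the action. -/
theorem exists_of_stable_homogeneous (hP : IsSimple P) {U : ZMod 2 → Submodule ℂ P.V}
    (hU : ∀ p, U p ≤ P.grade p) (hst : ∀ a p, ∀ v ∈ U p, P.act a v ∈ U (par a + p))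
    {p : ZMod 2} {v : P.V} (hv : v ∈ U p) (hv0 : v ≠ 0) : U 0 ⊔ U 1 = ⊤ := by
  have hle : ∀ q, U q ≤ U 0 ⊔ U 1 := by
    intro q
    rcases ZMod.two_cases q with rfl | rfl
    · exact le_sup_left
    · exact le_sup_right
  refine (hP.2 (U 0 ⊔ U 1) ⟨fun a _ x hx => ?_, fun x hx => ?_⟩).resolve_left fun h => hv0 ?_
  · obtain ⟨x0, h0, x1, h1, rfl⟩ := Submodule.mem_sup.1 hx
    rw [map_add]
    exact add_mem (hle _ (hst a 0 x0 h0)) (hle _ (hst a 1 x1 h1))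
  · obtain ⟨x0, h0, x1, h1, rfl⟩ := Submodule.mem_sup.1 hx
    exact ⟨x0, hle _ h0, hU _ h0, x1, hle _ h1, hU _ h1, rfl⟩
  · have := hle p hv
    rwa [h, Submodule.mem_bot] at this

/-- A stable subspace, graded or not, of a simple module is everything as soon as it contains a
nonzero homogeneous vector. -/
theorem eq_top_of_isStable (hP : IsSimple P) {U : Submodule ℂ P.V} (hU : IsStable P.act U)
    {p : ZMod 2} {v : P.V} (hv : v ∈ U) (hvp : v ∈ P.grade p) (hv0 : v ≠ 0) : U = ⊤ := by
  have := exists_of_stable_homogeneous hP (U := fun q => U ⊓ P.grade q) (fun q => inf_le_right)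
    (fun a q x hx => ⟨hU a x hx.1, P.act_grade a trivial q x hx.2⟩) (p := p) ⟨hv, hvp⟩ hv0
  exact top_le_iff.1 (this ▸ sup_le inf_le_left inf_le_left)

theorem grade_of_isStable (hP : IsSimple P) {N : GRep (Set.univ : Set SB)} {F : P.V →ₗ[ℂ] N.V}
    (hF : ∀ a v, F (P.act a v) = N.act a (F v)) {p : ZMod 2} {v : P.V} (hvp : v ∈ P.grade p)
    (hFv : F v ∈ N.grade p) (hv0 : v ≠ 0) (q : ZMod 2) : ∀ x ∈ P.grade q, F x ∈ N.grade q := by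
  have htop := exists_of_stable_homogeneous hP
    (U := fun q => P.grade q ⊓ (N.grade q).comap F) (fun q => inf_le_left)
    (fun a q x hx => ⟨P.act_grade a trivial q x hx.1, by
      change F (P.act a x) ∈ N.grade (par a + q)
      rw [hF]
      exact N.act_grade a trivial q _ hx.2⟩) (p := p) ⟨hvp, hFv⟩ hv0
  intro x hx
  obtain ⟨x0, h0, x1, h1, hsum⟩ := Submodule.mem_sup.1 (htop ▸ Submodule.mem_top (x := x))
  rcases ZMod.two_cases q with rfl | rfl
  · have := P.eq_zero_of_add_eq_zero (sub_mem h0.1 hx) h1.1 (by rw [← hsum]; abel)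
    rw [← hsum, this.2, add_zero]
    exact h0.2
  · have := P.eq_zero_of_add_eq_zero (p := 1) (sub_mem h1.1 hx) h0.1 (by rw [← hsum]; abel)
    rw [← hsum, this.2, zero_add]
    exact h1.2

theorem exists_homogeneous_ne_zero {U : Submodule ℂ ρ.V}
    (hU : ∀ v ∈ U, ∃ v0, v0 ∈ U ∧ v0 ∈ ρ.grade 0 ∧ ∃ v1, v1 ∈ U ∧ v1 ∈ ρ.grade 1 ∧ v = v0 + v1)
    {v : ρ.V} (hv : v ∈ U) (hv0 : v ≠ 0) : ∃ p, ∃ w ∈ U, w ∈ ρ.grade p ∧ w ≠ 0 := by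
  obtain ⟨v0, h0, g0, v1, h1, g1, rfl⟩ := hU v hv
  by_cases h : v0 = 0
  · refine ⟨1, v1, h1, g1, fun h' => hv0 (by rw [h, h', add_zero])⟩
  · exact ⟨0, v0, h0, g0, h⟩

/-- The vectors killed by `act a`, `a ∈ S`. -/
def killedBy (S : Set SB) : Submodule ℂ ρ.V := ⨅ a ∈ S, LinearMap.ker (ρ.act a)

theorem mem_killedBy {S : Set SB} {v : ρ.V} : v ∈ ρ.killedBy S ↔ ∀ a ∈ S, ρ.act a v = 0 := by
  simp [killedBy, Submodule.mem_iInf]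

theorem killedBy_graded {S : Set SB} (hS : S ⊆ Q) : ∀ v ∈ ρ.killedBy S,
    ∃ v0, v0 ∈ ρ.killedBy S ∧ v0 ∈ ρ.grade 0 ∧
      ∃ v1, v1 ∈ ρ.killedBy S ∧ v1 ∈ ρ.grade 1 ∧ v = v0 + v1 := by
  intro v hv
  obtain ⟨v0, h0, v1, h1, rfl⟩ := ρ.grade_sup v
  rw [mem_killedBy] at hv
  exact ⟨v0, ρ.mem_killedBy.2 fun a ha => (ρ.act_eq_zero_of_add (hS ha) h0 h1 (hv a ha)).1, h0,
    v1, ρ.mem_killedBy.2 fun a ha => (ρ.act_eq_zero_of_add (hS ha) h0 h1 (hv a ha)).2, h1, rfl⟩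

open Classical in
/-- The representation of a smaller subalgebra on a graded stable subspace. -/
noncomputable def subRep (P : GRep (Set.univ : Set SB)) (Q : Set SB) (V : Submodule ℂ P.V)
    (hst : ∀ a ∈ Q, ∀ v ∈ V, P.act a v ∈ V)
    (hgr : ∀ v ∈ V, ∃ v0, v0 ∈ V ∧ v0 ∈ P.grade 0 ∧ ∃ v1, v1 ∈ V ∧ v1 ∈ P.grade 1 ∧ v = v0 + v1)
    (hQ : ∀ a ∈ Q, ∀ b ∈ Q, ∀ c ∈ (sb a b).support, c ∈ Q) : GRep Q where
  V := V
  act a := if h : a ∈ Q then (P.act a).restrict (hst a h) else 0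
  grade p := (P.grade p).comap V.subtype
  grade_sup := by
    rintro ⟨v, hv⟩
    obtain ⟨v0, h0, g0, v1, h1, g1, rfl⟩ := hgr v hv
    exact ⟨⟨v0, h0⟩, g0, ⟨v1, h1⟩, g1, rfl⟩
  grade_inf := by
    rw [← Submodule.comap_inf, P.grade_inf, Submodule.comap_bot, Submodule.ker_subtype]
  act_grade a ha p v hv := by
    rw [dif_pos ha]
    exact P.act_grade a trivial p v hv
  act_br a ha b hb v := by
    rw [dif_pos ha, dif_pos hb]
    apply Subtype.ext
    have h := P.act_br a trivial b trivial v
    rw [Finsupp.sum] at h ⊢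
    rw [AddSubgroupClass.coe_sub, Submodule.coe_smul, Submodule.coe_sum]
    refine h.trans (Finset.sum_congr rfl fun c hc => ?_)
    rw [dif_pos (hQ a ha b hb c hc)]
    rfl

theorem subRep_act_of_mem (P : GRep (Set.univ : Set SB)) {Q : Set SB} {V : Submodule ℂ P.V}
    (hst : ∀ a ∈ Q, ∀ v ∈ V, P.act a v ∈ V)
    (hgr : ∀ v ∈ V, ∃ v0, v0 ∈ V ∧ v0 ∈ P.grade 0 ∧ ∃ v1, v1 ∈ V ∧ v1 ∈ P.grade 1 ∧ v = v0 + v1)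
    (hQ : ∀ a ∈ Q, ∀ b ∈ Q, ∀ c ∈ (sb a b).support, c ∈ Q) {a : SB} (ha : a ∈ Q) :
    (P.subRep Q V hst hgr hQ).act a = (P.act a).restrict (hst a ha) := dif_pos ha

end GRep

end Graded

section Induction

variable {α β z : ℕ}

theorem mem_QS_of_mem_support (hαβ : 2 * β ≤ α) : ∀ a ∈ QS α β, ∀ b ∈ QS α β,
    ∀ c ∈ (sb a b).support, c ∈ QS α β := by
  intro a ha b hb c hc
  cases a <;> cases b <;> simp only [sb, Finsupp.smul_single, Finsupp.support_zero] at hc <;>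
    first
    | exact absurd hc (Finset.notMem_empty _)
    | (have := Finsupp.support_single_subset hc
       rw [Finset.mem_singleton] at this
       subst this
       simp only [QS, Membership.mem, Set.Mem] at ha hb ⊢
       lia)

theorem mem_singularSet_of_mem_support (hαβ : 2 * β ≤ α) {a b c : SB} (ha : a ∈ singularSet α β z)
    (hb : b ∈ QS α β) (hc : c ∈ (sb a b).support) : c ∈ singularSet α β z := by
  cases a <;> cases b <;> simp only [sb, Finsupp.smul_single, Finsupp.support_zero] at hc <;>
    first
    | exact absurd hc (Finset.notMem_empty _)
    | (have := Finsupp.support_single_subset hc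
       rw [Finset.mem_singleton] at this
       subst this
       simp only [QS, singularSet, Membership.mem, Set.Mem] at ha hb ⊢
       lia)

theorem singularSet_subset_QS : singularSet α β z ⊆ QS α β := by
  intro a ha
  cases a <;> simp only [QS, singularSet, Membership.mem, Set.Mem] at ha ⊢ <;> lia

theorem isSingular_of_mem {M : Type*} [AddCommGroup M] [Module ℂ M] {act : SB → M →ₗ[ℂ] M}
    {Y : Submodule ℂ M} (hst : ∀ a ∈ QS α β, ∀ y ∈ Y, act a y ∈ Y)
    (hzero : ∀ a ∈ singularSet α β z, ∀ y ∈ Y, act a y = 0)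
    (hinj : ∀ y ∈ Y, act (.i z) y = 0 → y = 0) : IsSingular act α β z Y where
  l_mem j hj := hst (.l j) hj
  i_mem j hj := hst (.i j) hj
  g_mem j hj := hst (.g j) hj
  l_zero j hj := hzero (.l j) hj
  i_zero j hj := hzero (.i j) hj
  g_zero j hj := hzero (.g j) hj
  i_inj := hinj

theorem IsSingular.act_mem {M : Type*} [AddCommGroup M] [Module ℂ M] {act : SB → M →ₗ[ℂ] M}
    {Y : Submodule ℂ M} (hY : IsSingular act α β z Y) : ∀ a ∈ QS α β, ∀ y ∈ Y, act a y ∈ Y := by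
  intro a ha y hy
  cases a with
  | l j => exact hY.l_mem j ha y hy
  | i j => exact hY.i_mem j ha y hy
  | g j => exact hY.g_mem j ha y hy

variable {P : GRep (Set.univ : Set SB)}

/-- The singular vectors of `P` as a representation of 𝔖_{α,β}. -/
noncomputable def GRep.singularRep (P : GRep (Set.univ : Set SB)) (hαβ : 2 * β ≤ α)
    (hV : IsSingular P.act α β z (P.killedBy (singularSet α β z))) : GRep (QS α β) :=
  P.subRep (QS α β) (P.killedBy (singularSet α β z)) hV.act_mem
    (P.killedBy_graded (Set.subset_univ _)) (mem_QS_of_mem_support hαβ)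

section

variable (hαβ : 2 * β ≤ α) (hV : IsSingular P.act α β z (P.killedBy (singularSet α β z)))

/-- The inclusion of the singular vectors. -/
noncomputable def GRep.singularIncl : (P.singularRep hαβ hV).V →ₗ[ℂ] P.V :=
  (P.killedBy (singularSet α β z)).subtype

theorem GRep.singularIncl_injective : Function.Injective (P.singularIncl hαβ hV) :=
  Subtype.val_injective

theorem GRep.singularIncl_act {a : SB} (ha : a ∈ QS α β) (v : (P.singularRep hαβ hV).V) :
    P.singularIncl hαβ hV ((P.singularRep hαβ hV).act a v) =
      P.act a (P.singularIncl hαβ hV v) :=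
  congrArg Subtype.val (LinearMap.congr_fun (P.subRep_act_of_mem _ _ _ ha) v)

theorem GRep.singularIncl_mem_grade {p : ZMod 2} {v : (P.singularRep hαβ hV).V} :
    P.singularIncl hαβ hV v ∈ P.grade p ↔ v ∈ (P.singularRep hαβ hV).grade p := Iff.rfl

theorem GRep.act_singularIncl_eq_zero {a : SB} (ha : a ∈ singularSet α β z)
    (v : (P.singularRep hαβ hV).V) : P.act a (P.singularIncl hαβ hV v) = 0 :=
  P.mem_killedBy.1 v.2 a ha

theorem GRep.singularRep_act_eq_zero {a : SB} (ha : a ∈ singularSet α β z) :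
    (P.singularRep hαβ hV).act a = 0 := by
  ext v
  apply P.singularIncl_injective hαβ hV
  rw [P.singularIncl_act hαβ hV (singularSet_subset_QS ha), P.act_singularIncl_eq_zero hαβ hV ha,
    LinearMap.zero_apply, map_zero]

theorem GRep.singularRep_injective : Function.Injective ((P.singularRep hαβ hV).act (.i z)) := by
  rw [injective_iff_map_eq_zero]
  intro v hv
  apply P.singularIncl_injective hαβ hV
  rw [map_zero]
  refine hV.i_inj _ v.2 ?_
  have hz : SB.i z ∈ QS α β := by
    change -(α : ℤ) ≤ z
    lia
  have := P.singularIncl_act hαβ hV hz v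
  rw [hv, map_zero] at this
  exact this.symm

theorem GRep.isSimple_singularRep (hP : IsSimple P) {v : P.V}
    (hv : v ∈ P.killedBy (singularSet α β z)) (hv0 : v ≠ 0) :
    IsSimple (P.singularRep hαβ hV) := by
  refine ⟨⟨⟨v, hv⟩, fun h => hv0 (congrArg Subtype.val h)⟩, fun U hU => ?_⟩
  rw [or_iff_not_imp_left]
  intro hbot
  obtain ⟨u, hu, hu0⟩ := U.ne_bot_iff.1 hbot
  obtain ⟨p, w, hw, hwp, hw0⟩ := GRep.exists_homogeneous_ne_zero _ hU.2 hu hu0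
  have hY : IsSingular P.act α β z (U.map (P.singularIncl hαβ hV)) := by
    refine isSingular_of_mem ?_ ?_ ?_
    · rintro a ha _ ⟨x, hx, rfl⟩
      exact ⟨_, hU.1 a ha x hx, P.singularIncl_act hαβ hV ha x⟩
    · rintro a ha _ ⟨x, hx, rfl⟩
      exact P.act_singularIncl_eq_zero hαβ hV ha x
    · rintro _ ⟨x, hx, rfl⟩
      exact hV.i_inj _ x.2
  obtain ⟨Γ, hYΓ, hst, -, hΓ⟩ := hY.exists_stable P.satisfiesBrackets
  have htop : Γ = ⊤ := GRep.eq_top_of_isStable hP hst (hYΓ ⟨w, hw, rfl⟩) (p := p)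
    ((P.singularIncl_mem_grade hαβ hV).2 hwp)
    (by simpa using (P.singularIncl_injective hαβ hV).ne hw0)
  refine top_le_iff.1 fun x _ => ?_
  obtain ⟨y, hy, hyx⟩ := hΓ (P.singularIncl hαβ hV x) (htop ▸ Submodule.mem_top)
    fun a ha => P.act_singularIncl_eq_zero hαβ hV ha x
  rwa [← P.singularIncl_injective hαβ hV hyx]

/-- A homomorphism on singular vectors extends to the whole of a simple module. -/
theorem GRep.exists_extension (hP : IsSimple P) {p : ZMod 2} {w : (P.singularRep hαβ hV).V}
    (hwp : w ∈ (P.singularRep hαβ hV).grade p) (hw0 : w ≠ 0) (N : GRep (Set.univ : Set SB))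
    {f : (P.singularRep hαβ hV).V →ₗ[ℂ] N.V} (hf : SEquivMap (QS α β) (P.singularRep hαβ hV) N f) :
    ∃ F : P.V →ₗ[ℂ] N.V, (∀ a v, F (P.act a v) = N.act a (F v)) ∧
      F ∘ₗ P.singularIncl hαβ hV = f := by
  set ι := P.singularIncl hαβ hV
  have hιinj : Function.Injective ι := P.singularIncl_injective hαβ hV
  have hprod := P.satisfiesBrackets.prodMap N.satisfiesBrackets
  have hY : IsSingular (fun a => (P.act a).prodMap (N.act a)) α β z
      (LinearMap.range (ι.prod f)) := by
    refine isSingular_of_mem ?_ ?_ ?_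
    · rintro a ha _ ⟨x, rfl⟩
      exact ⟨_, Prod.ext (P.singularIncl_act hαβ hV ha x) (hf.1 a ha x)⟩
    · rintro a ha _ ⟨x, rfl⟩
      refine Prod.ext (P.act_singularIncl_eq_zero hαβ hV ha x) ?_
      change N.act a (f x) = 0
      rw [← hf.1 a (singularSet_subset_QS ha), P.singularRep_act_eq_zero hαβ hV ha,
        LinearMap.zero_apply, map_zero]
    · rintro _ ⟨x, rfl⟩ hx
      have hx0 : ι x = 0 := hV.i_inj _ x.2 (congrArg Prod.fst hx)
      rw [(map_eq_zero_iff ι hιinj).1 hx0, map_zero]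
  obtain ⟨Γ, hYΓ, hst, hnil, hΓ⟩ := hY.exists_stable hprod
  have hfst : Γ.map (LinearMap.fst ℂ P.V N.V) = ⊤ := by
    refine GRep.eq_top_of_isStable hP ?_ (v := ι w) (p := p) ⟨_, hYΓ ⟨w, rfl⟩, rfl⟩ hwp
      (by simpa using hιinj.ne hw0)
    rintro a _ ⟨x, hx, rfl⟩
    exact ⟨_, hst a x hx, rfl⟩
  have hzero : ∀ x ∈ Γ, x.1 = 0 → x = 0 := by
    intro x hx hx1
    by_contra hx0
    obtain ⟨y, hy, hy0, hyk⟩ := exists_ne_zero_killed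
      (S := Γ ⊓ LinearMap.ker (LinearMap.fst ℂ P.V N.V))
      (fun a _ y hy => ⟨hst a y hy.1, by
        have h1 : y.1 = 0 := hy.2
        change P.act a y.1 = 0
        rw [h1, map_zero]⟩) ⟨hx, hx1⟩ hx0 (hnil hx)
    obtain ⟨u, rfl⟩ := hΓ y hy.1 hyk
    have hu : ι u = 0 := hy.2
    rw [map_eq_zero_iff ι hιinj] at hu
    exact hy0 (by rw [hu, map_zero])
  let π : Γ →ₗ[ℂ] P.V := LinearMap.fst ℂ P.V N.V ∘ₗ Γ.subtype
  have hπ : Function.Bijective π := by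
    refine ⟨(injective_iff_map_eq_zero π).2 fun x hx => Subtype.ext (hzero x.1 x.2 hx), fun v => ?_⟩
    obtain ⟨x, hx, hxv⟩ := hfst ▸ Submodule.mem_top (x := v)
    exact ⟨⟨x, hx⟩, hxv⟩
  let e := LinearEquiv.ofBijective π hπ
  have hF : ∀ x ∈ Γ, (LinearMap.snd ℂ P.V N.V ∘ₗ Γ.subtype ∘ₗ e.symm.toLinearMap) x.1 = x.2 := by
    intro x hx
    have : e.symm x.1 = ⟨x, hx⟩ := e.symm_apply_eq.2 rfl
    simp [this]
  have hF' : ∀ v, ∃ x ∈ Γ, x.1 = v := fun v => ⟨(e.symm v).1, (e.symm v).2, e.apply_symm_apply v⟩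
  refine ⟨LinearMap.snd ℂ P.V N.V ∘ₗ Γ.subtype ∘ₗ e.symm.toLinearMap, fun a v => ?_,
    LinearMap.ext fun u => hF _ (hYΓ ⟨u, rfl⟩)⟩
  obtain ⟨x, hx, rfl⟩ := hF' v
  rw [hF x hx]
  exact hF _ (hst a x hx)

theorem GRep.isInduced_singularIncl (hP : IsSimple P) {p : ZMod 2} {w : (P.singularRep hαβ hV).V}
    (hwp : w ∈ (P.singularRep hαβ hV).grade p) (hw0 : w ≠ 0) :
    IsInduced (QS α β) (P.singularRep hαβ hV) P (P.singularIncl hαβ hV) := by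
  have hιw : P.singularIncl hαβ hV w ≠ 0 := by
    simpa using (P.singularIncl_injective hαβ hV).ne hw0
  refine ⟨⟨fun a ha v => P.singularIncl_act hαβ hV ha v, fun q v hv => hv⟩, fun N f hf => ?_⟩
  obtain ⟨F, hF, hFι⟩ := P.exists_extension hαβ hV hP hwp hw0 N hf
  have hFw : ∀ u, F (P.singularIncl hαβ hV u) = f u := LinearMap.congr_fun hFι
  refine ⟨F, ⟨⟨fun a _ v => hF a v, ?_⟩, hFι⟩, ?_⟩
  · exact GRep.grade_of_isStable hP hF hwp
      (v := P.singularIncl hαβ hV w) (by rw [hFw]; exact hf.2 p w hwp) hιw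
  · rintro G ⟨hG, hGι⟩
    have htop : LinearMap.ker (G - F) = ⊤ := by
      refine GRep.eq_top_of_isStable hP ?_ (v := P.singularIncl hαβ hV w) (p := p) ?_ hwp hιw
      · intro a v hv
        rw [LinearMap.mem_ker, LinearMap.sub_apply, sub_eq_zero] at hv ⊢
        rw [hF, hG.1 a trivial, hv]
      · rw [LinearMap.mem_ker, LinearMap.sub_apply, sub_eq_zero, hFw]
        exact LinearMap.congr_fun hGι w
    exact sub_eq_zero.1 (LinearMap.ker_eq_top.1 htop)

end

end Induction

section Equivalence

theorem foldr_act_zero {M : Type*} [AddCommGroup M] [Module ℂ M] (act : SB → M →ₗ[ℂ] M)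
    (l : List SB) : l.foldr (fun a u => act a u) 0 = 0 := by
  induction l with
  | nil => rfl
  | cons a l ih => rw [List.foldr_cons, ih, map_zero]

theorem foldr_act_replicate {M : Type*} [AddCommGroup M] [Module ℂ M] (act : SB → M →ₗ[ℂ] M)
    (a : SB) (n : ℕ) (v : M) :
    (List.replicate n a).foldr (fun a u => act a u) v = (act a ^ n) v := by
  induction n with
  | zero => rfl
  | succ n ih => rw [List.replicate_succ, List.foldr_cons, ih, pow_succ', Module.End.mul_apply]

theorem LocNil.locFin {W : Type} [AddCommGroup W] [Module ℂ W] {f : W →ₗ[ℂ] W} (hf : LocNil f) :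
    LocFin f := by
  intro v
  obtain ⟨n, hn⟩ := hf v
  have hfin : (Set.range fun m : ℕ => (f ^ m) v).Finite := by
    refine ((Set.finite_Iio n).image fun m => (f ^ m) v).insert 0 |>.subset ?_
    rintro _ ⟨m, rfl⟩
    rcases lt_or_ge m n with hm | hm
    · exact Or.inr ⟨m, hm, rfl⟩
    · refine Or.inl ?_
      change (f ^ m) v = 0
      rw [← Nat.sub_add_cancel hm, pow_add, Module.End.mul_apply, hn, map_zero]
  exact FiniteDimensional.span_of_finite ℂ hfin

theorem mem_Qrst_of_le_deg {r s t : ℕ} {a : SB} (ha : r + s + t ≤ a.deg) : a ∈ Qrst r s t := by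
  cases a <;> simp only [Qrst, SB.deg, Membership.mem, Set.Mem] at ha ⊢ <;> lia

theorem le_deg_of_mem_Qrst {r : ℕ} {a : SB} (ha : a ∈ Qrst r r r) : r ≤ a.deg := by
  cases a <;> exact ha

variable {P : GRep (Set.univ : Set SB)}

theorem AlgLocNil.locNil {Q : Set SB} (hP : AlgLocNil Q P) {a : SB} (ha : a ∈ Q) :
    LocNil (P.act a) := by
  intro v
  obtain ⟨n, hn⟩ := hP v
  refine ⟨n, ?_⟩
  rw [← foldr_act_replicate]
  exact hn _ (fun b hb => (List.eq_of_mem_replicate hb) ▸ ha) List.length_replicate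

theorem AlgLocFin.locFin {Q : Set SB} (hP : AlgLocFin Q P) {a : SB} (ha : a ∈ Q) :
    LocFin (P.act a) := by
  intro v
  have := hP v
  refine Submodule.finiteDimensional_of_le (Submodule.span_mono ?_) (S₂ := Submodule.span ℂ
    {w : P.V | ∃ l : List SB, (∀ a ∈ l, a ∈ Q) ∧ w = l.foldr (fun a u => P.act a u) v})
  rintro _ ⟨n, rfl⟩
  exact ⟨List.replicate n a, fun b hb => (List.eq_of_mem_replicate hb) ▸ ha,
    (foldr_act_replicate _ _ _ _).symm⟩

theorem algLocNil_of_nilPart_eq_top {Q : Set SB} (hnil : nilPart P.act Q = ⊤) :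
    AlgLocNil Q P := by
  intro v
  obtain ⟨n, hn⟩ := mem_nilPart.1 (hnil ▸ Submodule.mem_top (x := v))
  refine ⟨n, fun l hl hlen => ?_⟩
  induction n generalizing v l with
  | zero =>
    obtain rfl : v = 0 := by simpa [nilLayer] using hn
    exact foldr_act_zero _ _
  | succ n ih =>
    rcases List.eq_nil_or_concat l with rfl | ⟨l, a, rfl⟩
    · simp at hlen
    · rw [List.concat_eq_append, List.foldr_append, List.foldr_cons, List.foldr_nil]
      exact ih _ (mem_nilLayer_succ.1 hn a (hl a (by simp))) l
        (fun b hb => hl b (by simp [hb])) (by simpa using hlen)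

theorem finite_setOf_deg_mem_Icc (r k : ℤ) : {a : SB | a.deg ∈ Set.Icc r k}.Finite := by
  refine (((Set.finite_Icc r k).image SB.l).union (((Set.finite_Icc r k).image SB.i).union
    ((Set.finite_Icc r k).image SB.g))).subset ?_
  rintro (m | m | m) hm
  · exact Or.inl ⟨m, hm, rfl⟩
  · exact Or.inr (Or.inl ⟨m, hm, rfl⟩)
  · exact Or.inr (Or.inr ⟨m, hm, rfl⟩)

theorem algLocFin_of_nilPart_eq_top {Q : Set SB} {r : ℤ} (hQ : ∀ a ∈ Q, r ≤ a.deg)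
    (hnil : nilPart P.act Q = ⊤) (hres : restrictedPart P.act = ⊤) : AlgLocFin Q P := by
  intro v
  obtain ⟨n, hn⟩ := mem_nilPart.1 (hnil ▸ Submodule.mem_top (x := v))
  induction n generalizing v with
  | zero =>
    obtain rfl : v = 0 := by simpa [nilLayer] using hn
    refine FiniteDimensional.span_of_finite ℂ ((Set.finite_singleton (0 : P.V)).subset ?_)
    rintro _ ⟨l, -, rfl⟩
    exact foldr_act_zero _ _
  | succ n ih =>
    obtain ⟨k, hk⟩ := mem_restrictedPart.1 (hres ▸ Submodule.mem_top (x := v))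
    set words : P.V → Submodule ℂ P.V := fun v => Submodule.span ℂ
      {w : P.V | ∃ l : List SB, (∀ a ∈ l, a ∈ Q) ∧ w = l.foldr (fun a u => P.act a u) v}
    let S : Set SB := {a | a.deg ∈ Set.Icc r k} ∩ Q
    have hS : Finite S := ((finite_setOf_deg_mem_Icc r k).inter_of_left Q).to_subtype
    have hfin : ∀ a : S, FiniteDimensional ℂ (words (P.act a v)) := fun a =>
      ih _ (mem_nilLayer_succ.1 hn a a.2.2)
    refine Submodule.finiteDimensional_of_le
      (S₂ := Submodule.span ℂ {v} ⊔ ⨆ a : S, words (P.act a v)) (Submodule.span_le.2 ?_)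
    rintro _ ⟨l, hl, rfl⟩
    rcases List.eq_nil_or_concat l with rfl | ⟨l, a, rfl⟩
    · exact Submodule.mem_sup_left (Submodule.mem_span_singleton_self v)
    · rw [List.concat_eq_append, List.foldr_append, List.foldr_cons, List.foldr_nil]
      have ha : a ∈ Q := hl a (by simp)
      rcases le_total (k : ℤ) a.deg with hka | hka
      · rw [hk a hka, foldr_act_zero]
        exact zero_mem _
      · exact Submodule.mem_sup_right (Submodule.mem_iSup_of_mem (⟨a, ⟨hQ a ha, hka⟩, ha⟩ : S)
          (Submodule.subset_span ⟨l, fun b hb => hl b (by simp [hb]), rfl⟩))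

theorem restrictedPart_eq_top (hP : IsSimple P) {p : ZMod 2} {v : P.V}
    (hv : v ∈ restrictedPart P.act) (hvp : v ∈ P.grade p) (hv0 : v ≠ 0) :
    restrictedPart P.act = ⊤ :=
  GRep.eq_top_of_isStable hP (isStable_restrictedPart P.satisfiesBrackets) hv hvp hv0

theorem restrictedPart_eq_top_of_locFin (hP : IsSimple P) {z : ℕ}
    (hfin : ∀ i : ℤ, (z : ℤ) ≤ i → LocFin (P.act (.l i))) : restrictedPart P.act = ⊤ := by
  obtain ⟨w, hw⟩ := hP.1
  obtain ⟨v, hv, hv0⟩ := exists_ne_zero_mem_restrictedPart P.satisfiesBrackets hfin hw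
  obtain ⟨k, hk⟩ := mem_restrictedPart.1 hv
  obtain ⟨p, u, hu, hup, hu0⟩ := P.exists_homogeneous_ne_zero
    (P.killedBy_graded (S := {a | (k : ℤ) ≤ a.deg}) (Set.subset_univ _))
    (P.mem_killedBy.2 hk) hv0
  exact restrictedPart_eq_top hP (mem_restrictedPart.2 ⟨k, P.mem_killedBy.1 hu⟩) hup hu0

/-- Some singular set has nonzero killed vectors, which form a singular subspace. -/
theorem exists_isSingular (hP : IsSimple P) (hres : restrictedPart P.act = ⊤) {k : ℕ}
    (hk : Function.Injective (P.act (.i (k : ℤ)))) :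
    ∃ α β z : ℕ, 2 * β ≤ α ∧ IsSingular P.act α β z (P.killedBy (singularSet α β z)) ∧
      ∃ v ∈ P.killedBy (singularSet α β z), v ≠ 0 := by
  classical
  have hres' : ∀ v, ∃ K : ℕ, ∀ a : SB, (K : ℤ) ≤ a.deg → P.act a v = 0 := fun v =>
    mem_restrictedPart.1 (hres ▸ Submodule.mem_top)
  have hex : ∃ n : ℕ, ∃ v : P.V, v ≠ 0 ∧ ∀ j : ℤ, (n : ℤ) ≤ j → P.act (.i j) v = 0 := by
    obtain ⟨v, hv⟩ := hP.1
    obtain ⟨K, hK⟩ := hres' v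
    exact ⟨K, v, hv, fun j hj => hK (.i j) hj⟩
  obtain ⟨v, hv0, hv⟩ := Nat.find_spec hex
  have hpos : 0 < Nat.find hex := by
    rw [Nat.pos_iff_ne_zero]
    intro h0
    refine hv0 ((map_eq_zero_iff _ hk).1 (hv k ?_))
    rw [h0]
    exact_mod_cast k.zero_le
  obtain ⟨z, hz⟩ := Nat.exists_eq_succ_of_ne_zero hpos.ne'
  obtain ⟨K, hK⟩ := hres' v
  have hα : 2 * K ≤ 2 * K := le_rfl
  refine ⟨2 * K, K, z, hα, isSingular_of_mem ?_ ?_ ?_, v, P.mem_killedBy.2 ?_, hv0⟩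
  · intro b hb y hy
    rw [GRep.mem_killedBy] at hy ⊢
    intro a ha
    rw [P.satisfiesBrackets.comm_eq, hy a ha, map_zero, smul_zero, zero_add]
    exact Finset.sum_eq_zero fun c hc => by
      simp only [hy c (mem_singularSet_of_mem_support hα ha hb hc), smul_zero]
  · exact fun a ha y hy => P.mem_killedBy.1 hy a ha
  · intro y hy hzy
    by_contra hy0
    refine Nat.find_min hex (m := z) (by lia) ⟨y, hy0, fun j hj => ?_⟩
    rcases hj.eq_or_lt with rfl | hj
    · exact hzy
    · exact P.mem_killedBy.1 hy (.i j) hj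
  · intro a ha
    cases a with
    | l j =>
      refine hK _ ?_
      have : (z : ℤ) + (2 * K : ℕ) < j := ha
      change (K : ℤ) ≤ j
      push_cast at this
      lia
    | i j =>
      have : (z : ℤ) < j := ha
      refine hv j ?_
      rw [hz]
      push_cast
      lia
    | g j =>
      refine hK _ ?_
      have : (z : ℤ) + K < j := ha
      change (K : ℤ) ≤ j
      lia

theorem IsInduced.ne_zero (hP : ∃ v : P.V, v ≠ 0) {Q : Set SB} {ρ : GRep Q} {ι : ρ.V →ₗ[ℂ] P.V}
    (hι : IsInduced Q ρ P ι) : ι ≠ 0 := by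
  intro h0
  obtain ⟨v, hv⟩ := hP
  obtain ⟨F, -, hF⟩ := hι.2 P ι hι.1
  have h1 := hF LinearMap.id ⟨⟨fun _ _ _ => rfl, fun _ _ h => h⟩, LinearMap.id_comp ι⟩
  have h2 := hF 0 ⟨⟨fun a _ v => by simp, fun p _ _ => zero_mem _⟩, by rw [h0, LinearMap.comp_zero]⟩
  exact hv (LinearMap.congr_fun (h1.trans h2.symm) v)

/-- A module induced from a representation killed by a singular set is restricted, and locally
nilpotent over a subalgebra `𝔖^{(r,r,r)}`. -/
theorem IsInduced.exists_nilPart_eq_top (hP : IsSimple P) {α β z : ℕ} (hαβ : 2 * β ≤ α)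
    {ρ : GRep (QS α β)} (hl : ∀ i : ℤ, (z : ℤ) + (α : ℤ) < i → ρ.act (.l i) = 0)
    (hg : ∀ j : ℤ, (z : ℤ) + (β : ℤ) < j → ρ.act (.g j) = 0)
    (hi : ∀ j : ℤ, (z : ℤ) < j → ρ.act (.i j) = 0) {ι : ρ.V →ₗ[ℂ] P.V}
    (hι : IsInduced (QS α β) ρ P ι) :
    ∃ r : ℕ, nilPart P.act (Qrst r r r) = ⊤ ∧ restrictedPart P.act = ⊤ := by
  obtain ⟨p, v, hv, hv0⟩ : ∃ p, ∃ v ∈ ρ.grade p, ι v ≠ 0 := by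
    by_contra! H
    refine hι.ne_zero hP.1 (LinearMap.ext fun v => ?_)
    obtain ⟨v0, h0, v1, h1, rfl⟩ := ρ.grade_sup v
    rw [map_add, H 0 v0 h0, H 1 v1 h1, add_zero, LinearMap.zero_apply]
  have hgr : ι v ∈ P.grade p := hι.1.2 p v hv
  have hkill : ∀ a : SB, ((z + α + 1 : ℕ) : ℤ) ≤ a.deg → P.act a (ι v) = 0 := by
    intro a ha
    push_cast at ha
    have hρ : a ∈ QS α β ∧ ρ.act a = 0 := by
      cases a with
      | l j =>
        change _ ≤ j at ha
        exact ⟨show 0 ≤ j by lia, hl j (by lia)⟩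
      | i j =>
        change _ ≤ j at ha
        exact ⟨show -(α : ℤ) ≤ j by lia, hi j (by lia)⟩
      | g j =>
        change _ ≤ j at ha
        exact ⟨show -(β : ℤ) ≤ j by lia, hg j (by lia)⟩
    rw [← hι.1.1 a hρ.1, hρ.2, LinearMap.zero_apply, map_zero]
  refine ⟨z + α + 1, ?_, restrictedPart_eq_top hP (mem_restrictedPart.2 ⟨_, hkill⟩) hgr hv0⟩
  refine GRep.eq_top_of_isStable hP (isStable_nilPart (D := (z + α + 1 : ℕ)) P.satisfiesBrackets
    (fun a ha => ?_) fun a ha => ?_) (mem_nilPart.2 ⟨1, mem_nilLayer_succ.2 fun a ha => ?_⟩) hgr hv0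
  · have := le_deg_of_mem_Qrst ha
    push_cast at this
    lia
  · cases a <;> exact ha
  · rw [hkill a (le_deg_of_mem_Qrst ha)]
    exact zero_mem _

end Equivalence

/-- For a simple 𝔖-module `P` on which some `I_k` acts injectively,
the five conditions of Proposition 5.1 are equivalent. -/
theorem simple_module_tfae (P : GRep (Set.univ : Set SB)) (hsimple : IsSimple P)
    (k : ℕ) (hk : Function.Injective (P.act (.i (k : ℤ)))) :
    List.TFAE [
      -- (1) the actions of L_i, G_i, I_i (i ≥ z) are locally finite
      ∃ z : ℕ, ∀ i : ℤ, (z : ℤ) ≤ i →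
        LocFin (P.act (.l i)) ∧ LocFin (P.act (.g i)) ∧ LocFin (P.act (.i i)),
      -- (2) the actions of L_i, G_i, I_i (i ≥ z) are locally nilpotent
      ∃ z : ℕ, ∀ i : ℤ, (z : ℤ) ≤ i →
        LocNil (P.act (.l i)) ∧ LocNil (P.act (.g i)) ∧ LocNil (P.act (.i i)),
      -- (3) P is a locally finite 𝔖^{(r,s,t)}-module
      ∃ r s t : ℕ, AlgLocFin (Qrst r s t) P,
      -- (4) P is a locally nilpotent 𝔖^{(r,s,t)}-module
      ∃ r s t : ℕ, AlgLocNil (Qrst r s t) P,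
      -- (5) P ≅ Ind(V) for a simple 𝔖_{α,β}-module V as in Theorem 4.3
      ∃ α β z : ℕ, 2 * β ≤ α ∧ ∃ ρV : GRep (QS α β), IsSimple ρV ∧
        Function.Injective (ρV.act (.i (z : ℤ))) ∧
        (∀ i : ℤ, (z : ℤ) + (α : ℤ) < i → ρV.act (.l i) = 0) ∧
        (∀ j : ℤ, (z : ℤ) + (β : ℤ) < j → ρV.act (.g j) = 0) ∧
        (∀ j : ℤ, (z : ℤ) < j → ρV.act (.i j) = 0) ∧
        ∃ ι : ρV.V →ₗ[ℂ] P.V, IsInduced (QS α β) ρV P ι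
    ] := by
  tfae_have 1 → 5 := by
    rintro ⟨z, hz⟩
    obtain ⟨α, β, z, hαβ, hV, v, hv, hv0⟩ :=
      exists_isSingular hsimple (restrictedPart_eq_top_of_locFin hsimple fun i hi => (hz i hi).1) hk
    have hsimpleV := P.isSimple_singularRep hαβ hV hsimple hv hv0
    obtain ⟨w, hw0⟩ := hsimpleV.1
    obtain ⟨p, w, -, hwp, hw0⟩ := GRep.exists_homogeneous_ne_zero (P.singularRep hαβ hV) (U := ⊤)
      (fun u _ => by
        obtain ⟨u0, h0, u1, h1, rfl⟩ := (P.singularRep hαβ hV).grade_sup u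
        exact ⟨u0, trivial, h0, u1, trivial, h1, rfl⟩) trivial hw0
    exact ⟨α, β, z, hαβ, P.singularRep hαβ hV, hsimpleV, P.singularRep_injective hαβ hV,
      fun i hi => P.singularRep_act_eq_zero hαβ hV (a := .l i) hi,
      fun j hj => P.singularRep_act_eq_zero hαβ hV (a := .g j) hj,
      fun j hj => P.singularRep_act_eq_zero hαβ hV (a := .i j) hj,
      P.singularIncl hαβ hV, P.isInduced_singularIncl hαβ hV hsimple hwp hw0⟩
  tfae_have 5 → 4 := by
    rintro ⟨α, β, z, hαβ, ρ, -, -, hl, hg, hi, ι, hι⟩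
    obtain ⟨r, hnil, -⟩ := hι.exists_nilPart_eq_top hsimple hαβ hl hg hi
    exact ⟨r, r, r, algLocNil_of_nilPart_eq_top hnil⟩
  tfae_have 5 → 3 := by
    rintro ⟨α, β, z, hαβ, ρ, -, -, hl, hg, hi, ι, hι⟩
    obtain ⟨r, hnil, hres⟩ := hι.exists_nilPart_eq_top hsimple hαβ hl hg hi
    exact ⟨r, r, r, algLocFin_of_nilPart_eq_top (fun a ha => le_deg_of_mem_Qrst ha) hnil hres⟩
  tfae_have 4 → 2 := by
    rintro ⟨r, s, t, h⟩
    refine ⟨r + s + t, fun i hi => ?_⟩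
    push_cast at hi
    exact ⟨h.locNil (mem_Qrst_of_le_deg (a := .l i) hi),
      h.locNil (mem_Qrst_of_le_deg (a := .g i) hi), h.locNil (mem_Qrst_of_le_deg (a := .i i) hi)⟩
  tfae_have 3 → 1 := by
    rintro ⟨r, s, t, h⟩
    refine ⟨r + s + t, fun i hi => ?_⟩
    push_cast at hi
    exact ⟨h.locFin (mem_Qrst_of_le_deg (a := .l i) hi),
      h.locFin (mem_Qrst_of_le_deg (a := .g i) hi), h.locFin (mem_Qrst_of_le_deg (a := .i i) hi)⟩
  tfae_have 2 → 1 := by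
    rintro ⟨z, hz⟩
    exact ⟨z, fun i hi => ⟨(hz i hi).1.locFin, (hz i hi).2.1.locFin, (hz i hi).2.2.locFin⟩⟩
  tfae_finish
end

section
/- Let z ∈ ℤ≥0 and let V′ be a finite-dimensional module over the Lie superalgebra 𝔖^{(z,z,z)}. Then there exists m > z such that L_j V′ = G_j V′ = I_j V′ = 0 for all j > m + z; in particular, all but finitely many of L_i, G_i, I_i (i ≥ z) annihilate V′. -/
/-- Bracketing a linear relation among the `A (i + s)` with `A n`. -/
theorem sum_smul_shift_of_witt_relations {R : Type*} [Ring R] [Algebra ℂ R] {z : ℤ}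
    {A : ℤ → R}
    (hA : ∀ m n, z ≤ m → z ≤ n → A m * A n - A n * A m = ((n : ℂ) - (m : ℂ)) • A (m + n))
    {F : Finset ℕ} {a : ℕ → ℂ} {s n : ℤ} (hs : z ≤ s) (hn : z ≤ n)
    (h : ∑ i ∈ F, a i • A (i + s) = 0) :
    ∑ i ∈ F, (a i * ((i : ℂ) + s - n)) • A (i + (s + n)) = 0 := by
  have key : A n * (∑ i ∈ F, a i • A (i + s)) - (∑ i ∈ F, a i • A (i + s)) * A n = 0 := by
    rw [h]; simp
  rw [Finset.mul_sum, Finset.sum_mul, ← Finset.sum_sub_distrib] at key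
  rw [← key]
  refine Finset.sum_congr rfl fun i _ => ?_
  rw [mul_smul_comm, smul_mul_assoc, ← smul_sub, hA n (i + s) hn (by omega), smul_smul]
  push_cast
  rw [show (i : ℤ) + (s + n) = n + (i + s) by ring]

/-- A relation among translates that persists under all large shifts kills a whole tail. -/
theorem eventually_zero_of_shifted_relation {R : Type*} [Ring R] [Algebra ℂ R] {z : ℤ}
    (hz : 0 ≤ z) {A : ℤ → R}
    (hA : ∀ m n, z ≤ m → z ≤ n → A m * A n - A n * A m = ((n : ℂ) - (m : ℂ)) • A (m + n))
    (F : Finset ℕ) (hF : F.Nonempty) (a : ℕ → ℂ) (ha : ∀ i ∈ F, a i ≠ 0) (N : ℤ) (hN : z ≤ N)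
    (h : ∀ s, N ≤ s → ∑ i ∈ F, a i • A (i + s) = 0) :
    ∃ M : ℤ, ∀ s, M ≤ s → A s = 0 := by
  induction hF using Finset.Nonempty.cons_induction generalizing a N with
  | singleton c =>
    refine ⟨c + N, fun s hs => ?_⟩
    have := h (s - c) (by omega)
    rw [Finset.sum_singleton, add_sub_cancel] at this
    exact (smul_eq_zero.1 this).resolve_left (ha c (by simp))
  | cons c F hc hF ih =>
    refine ih (fun i => a i * ((i : ℂ) - c)) (fun i hi => ?_) (N + z) (by omega) fun t ht => ?_
    · refine mul_ne_zero (ha i (by simp [hi])) (sub_ne_zero.2 fun e => hc ?_)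
      rwa [← Nat.cast_injective e]
    · have h1 := sum_smul_shift_of_witt_relations hA (s := t - z) (by omega) le_rfl
        (h (t - z) (by omega))
      rw [sub_add_cancel] at h1
      have h2 := congrArg (fun x => ((t : ℂ) - 2 * z + c) • x) (h t (by omega))
      simp only [smul_zero, Finset.smul_sum, smul_smul] at h2
      have h3 := congrArg₂ (· - ·) h1 h2
      simp only [← Finset.sum_sub_distrib, ← sub_smul, sub_zero] at h3
      have h5 : ∑ i ∈ F, (a i * ((i : ℂ) - c)) • A (i + t) =
          ∑ i ∈ F.cons c hc, (a i * ((i : ℂ) - c)) • A (i + t) := by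
        simp
      rw [h5, ← h3]
      refine Finset.sum_congr rfl fun i _ => ?_
      congr 1
      push_cast; ring

/-- A finite-dimensional algebra contains only finitely many nonzero elements satisfying the
commutation relations of a positive part of the Witt algebra. -/
theorem eventually_zero_of_witt_relations {R : Type*} [Ring R] [Algebra ℂ R]
    [FiniteDimensional ℂ R] {z : ℤ} (hz : 0 ≤ z) {A : ℤ → R}
    (hA : ∀ m n, z ≤ m → z ≤ n → A m * A n - A n * A m = ((n : ℂ) - (m : ℂ)) • A (m + n)) :
    ∃ M : ℤ, ∀ s, M ≤ s → A s = 0 := by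
  have hdep : ¬ LinearIndependent ℂ fun i : ℕ => A (i + z) := fun hli =>
    not_finite_iff_infinite.2 inferInstance hli.finite
  obtain ⟨F, a, h0, c, hcF, hc⟩ := not_linearIndependent_iff.1 hdep
  refine eventually_zero_of_shifted_relation hz hA (F.filter fun i => a i ≠ 0)
    ⟨c, by simp [hcF, hc]⟩ a (by simp) (3 * z + 2) (by omega) fun s hs => ?_
  have hsum : ∑ i ∈ F with a i ≠ 0, a i • A (i + s) = ∑ i ∈ F, a i • A (i + s) :=
    Finset.sum_filter_of_ne fun i _ h e => h (by rw [e, zero_smul])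
  rw [hsum]
  have P : ∀ n, z ≤ n → z ≤ s - z - n →
      ∑ i ∈ F, (a i * ((i : ℂ) + z - n) * ((i : ℂ) + (z + n) - (s - z - n))) • A (i + s) = 0 := by
    intro n hn hm
    have h1 := sum_smul_shift_of_witt_relations hA le_rfl hn h0
    have h2 := sum_smul_shift_of_witt_relations hA (by omega) hm h1
    rw [show z + n + (s - z - n) = s by ring] at h2
    push_cast at h2
    exact h2
  have p0 := P z le_rfl (by omega)
  have p1 := P (z + 1) (by omega) (by omega)
  have p2 := P (z + 2) (by omega) (by omega)
  have h4 : (-4 : ℂ) • ∑ i ∈ F, a i • A (i + s) = 0 := by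
    rw [← sub_eq_zero.2 (p0.trans p1.symm), ← sub_zero (_ - _),
      ← sub_eq_zero.2 (p1.trans p2.symm)]
    simp only [Finset.smul_sum, smul_smul, ← Finset.sum_sub_distrib, ← sub_smul]
    refine Finset.sum_congr rfl fun i _ => ?_
    congr 1
    push_cast; ring
  exact (smul_eq_zero.1 h4).resolve_left (by norm_num)

/-- If `V'` is a finite-dimensional module over 𝔖^{(z,z,z)}, then
there is `m > z` with `L_j V' = G_j V' = I_j V' = 0` for all `j > m + z`; in particular
all but finitely many of the `L_i, G_i, I_i` (i ≥ z) annihilate `V'`. -/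
theorem finite_dim_module_annihilated (z : ℕ) (ρ : GRep (Qrst z z z))
    (hfd : FiniteDimensional ℂ ρ.V) :
    ∃ m : ℤ, (z : ℤ) < m ∧ ∀ j : ℤ, m + (z : ℤ) < j →
      ρ.act (.l j) = 0 ∧ ρ.act (.g j) = 0 ∧ ρ.act (.i j) = 0 := by
  have hz : (0 : ℤ) ≤ z := Int.natCast_nonneg z
  obtain ⟨M, hM⟩ : ∃ M : ℤ, ∀ s, M ≤ s → (ρ.act (.l s) : Module.End ℂ ρ.V) = 0 := by
    refine eventually_zero_of_witt_relations (R := Module.End ℂ ρ.V) hz fun m n hm hn => ?_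
    ext v
    have h := ρ.act_br (.l m) hm (.l n) hn v
    rw [sb, Finsupp.smul_single_one, Finsupp.sum_single_index (by simp)] at h
    simpa [sgn, par] using h
  refine ⟨max (M + 1) (z + 1), by omega, fun j hj => ⟨hM j (by omega), ?_, ?_⟩⟩
  all_goals
    have hL := hM (j - (z + 1)) (by omega)
    have hc : (z : ℂ) + 1 ≠ 0 := Nat.cast_add_one_ne_zero z
    have hm : (z : ℤ) ≤ j - (z + 1) := by omega
    have hn : (z : ℤ) ≤ z + 1 := by omega
    ext v
  · have h := ρ.act_br (.l (j - (z + 1))) hm (.g (z + 1)) hn v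
    rw [sb, Finsupp.smul_single_one, Finsupp.sum_single_index (by simp)] at h
    simpa [hL, hc] using h.symm
  · have h := ρ.act_br (.l (j - (z + 1))) hm (.i (z + 1)) hn v
    rw [sb, Finsupp.smul_single_one, Finsupp.sum_single_index (by simp)] at h
    simpa [hL, hc] using h.symm
end

section
/- Every finite-dimensional simple module over the Lie superalgebra T(1) = 𝔖^{(1,1,1)} is one-dimensional. -/
section WittVanishing

variable {A : Type*} [Ring A] [Algebra ℂ A] {X : ℕ → A}

/-- Bracketing a linear relation among elements satisfying the Witt relations with `X m`. -/
lemma witt_relation_bracket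
    (hX : ∀ m n : ℕ, 1 ≤ m → 1 ≤ n → X m * X n - X n * X m = ((n : ℂ) - m) • X (m + n))
    {S : Finset ℕ} {c : ℕ → ℂ} {t m : ℕ} (ht : 1 ≤ t) (hm : 1 ≤ m)
    (h : ∑ i ∈ S, c i • X (i + t) = 0) :
    ∑ i ∈ S, (c i * ((i : ℂ) + t - m)) • X (i + (t + m)) = 0 := by
  have key : ∑ i ∈ S, (c i * ((i : ℂ) + t - m)) • X (i + (t + m))
      = X m * (∑ i ∈ S, c i • X (i + t)) - (∑ i ∈ S, c i • X (i + t)) * X m := by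
    rw [Finset.mul_sum, Finset.sum_mul, ← Finset.sum_sub_distrib]
    refine Finset.sum_congr rfl fun i _ => ?_
    rw [mul_smul_comm, smul_mul_assoc, ← smul_sub, hX m (i + t) hm (by omega), smul_smul,
      show m + (i + t) = i + (t + m) by omega]
    push_cast
    rfl
  rw [key, h]
  simp

/-- A nontrivial linear relation holding together with all its large shifts forces
`X n = 0` for all large `n`. -/
lemma witt_eventually_zero_of_shifts
    (hX : ∀ m n : ℕ, 1 ≤ m → 1 ≤ n → X m * X n - X n * X m = ((n : ℂ) - m) • X (m + n))
    (S : Finset ℕ) : ∀ (c : ℕ → ℂ) (s₀ : ℕ), (∃ i ∈ S, c i ≠ 0) →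
      (∀ s, s₀ ≤ s → ∑ i ∈ S, c i • X (i + s) = 0) → ∃ N, ∀ n, N ≤ n → X n = 0 := by
  induction S using Finset.induction_on with
  | empty => rintro c s₀ ⟨i, hi, -⟩; simp at hi
  | insert j S hj ih =>
    intro c s₀ hc hs
    by_cases hS : ∃ i ∈ S, c i ≠ 0
    · obtain ⟨i, hi, hci⟩ := hS
      refine ih (fun i => c i * ((i : ℂ) - j)) (s₀ + 2) ⟨i, hi, mul_ne_zero hci ?_⟩ fun s hs' => ?_
      · rw [sub_ne_zero]
        rintro h
        exact hj (Nat.cast_injective (R := ℂ) h ▸ hi)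
      · obtain ⟨t, rfl⟩ : ∃ t, s = t + 1 := ⟨s - 1, by omega⟩
        have h1 := witt_relation_bracket hX (by omega) le_rfl (hs t (by omega))
        have h2 := congrArg (fun v => ((j : ℂ) + t - 1) • v) (hs (t + 1) (by omega))
        simp only [Finset.smul_sum, smul_smul, smul_zero] at h2
        have h3 := congrArg₂ (· - ·) h1 h2
        simp only [← Finset.sum_sub_distrib, ← sub_smul, sub_zero] at h3
        rw [Finset.sum_insert hj] at h3
        rw [← h3]
        push_cast
        rw [show c j * ((j : ℂ) + t - 1) - (j + t - 1) * c j = 0 by ring, zero_smul, zero_add]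
        refine Finset.sum_congr rfl fun i _ => ?_
        congr 1
        ring
    · push Not at hS
      have hcj : c j ≠ 0 := by
        obtain ⟨i, hi, hci⟩ := hc
        rcases Finset.mem_insert.1 hi with rfl | hi
        · exact hci
        · exact absurd (hS i hi) hci
      refine ⟨j + s₀, fun n hn => ?_⟩
      have h := hs (n - j) (by omega)
      rw [Finset.sum_insert hj, Finset.sum_eq_zero (fun i hi => by rw [hS i hi, zero_smul]),
        add_zero, show j + (n - j) = n by omega] at h
      exact (smul_eq_zero.1 h).resolve_left hcj

/-- In a finite-dimensional algebra, elements satisfying the Witt relations vanish eventually. -/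
lemma witt_eventually_zero [FiniteDimensional ℂ A]
    (hX : ∀ m n : ℕ, 1 ≤ m → 1 ≤ n → X m * X n - X n * X m = ((n : ℂ) - m) • X (m + n)) :
    ∃ N, ∀ n, N ≤ n → X n = 0 := by
  have hdep : ¬ LinearIndependent ℂ (fun i : ℕ => X (i + 1)) := fun h =>
    not_finite_iff_infinite.2 (inferInstanceAs (Infinite ℕ)) h.finite
  rw [linearIndependent_iff'] at hdep
  push Not at hdep
  obtain ⟨S, c, hS, hc⟩ := hdep
  refine witt_eventually_zero_of_shifts hX S c 5 hc fun s hs => ?_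
  obtain ⟨s, rfl⟩ : ∃ r, s = r + 5 := ⟨s - 5, by omega⟩
  have F (m m' : ℕ) (hm : 1 ≤ m) (hm' : 1 ≤ m') :=
    witt_relation_bracket hX (by omega) hm' (witt_relation_bracket hX le_rfl hm hS)
  have h1 := F 1 (s + 3) (by omega) (by omega)
  have h2 := congrArg (fun v => (2 : ℂ) • v) (F 2 (s + 2) (by omega) (by omega))
  have h3 := F 3 (s + 1) (by omega) (by omega)
  simp only [Finset.smul_sum, smul_smul, smul_zero] at h2
  have h4 := congrArg₂ (· + ·) (congrArg₂ (· - ·) h1 h2) h3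
  simp only [show 1 + 1 + (s + 3) = s + 5 by omega, show 1 + 2 + (s + 2) = s + 5 by omega,
    show 1 + 3 + (s + 1) = s + 5 by omega, ← Finset.sum_sub_distrib, ← Finset.sum_add_distrib,
    ← sub_smul, ← add_smul, sub_zero, add_zero] at h4
  have h5 : (-4 : ℂ) • ∑ i ∈ S, c i • X (i + (s + 5)) = 0 := by
    rw [Finset.smul_sum, ← h4]
    refine Finset.sum_congr rfl fun i _ => ?_
    rw [smul_smul]
    congr 1
    push_cast
    ring
  exact (smul_eq_zero.1 h5).resolve_left (by norm_num)

end WittVanishing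

namespace GRep

section General

variable {Q : Set SB} {ρ : GRep Q}

lemma eq_zero_of_add_eq_zero_s10 (p : ZMod 2) {x y : ρ.V} (hx : x ∈ ρ.grade p)
    (hy : y ∈ ρ.grade (p + 1)) (h : x + y = 0) : x = 0 ∧ y = 0 := by
  have hxy : x = -y := eq_neg_of_add_eq_zero_left h
  have hx' : x ∈ ρ.grade (p + 1) := hxy ▸ neg_mem hy
  have : x ∈ ρ.grade 0 ⊓ ρ.grade 1 := by
    fin_cases p
    · exact ⟨hx, hx'⟩
    · exact ⟨hx', hx⟩
  rw [ρ.grade_inf, Submodule.mem_bot] at this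
  exact ⟨this, by rw [this, zero_add] at h; exact h⟩

/-- The kernel of a homogeneous operator is a graded submodule as soon as it is stable. -/
lemma isSub_ker (p : ZMod 2) (f : ρ.V →ₗ[ℂ] ρ.V)
    (hf : ∀ q, ∀ v ∈ ρ.grade q, f v ∈ ρ.grade (p + q))
    (hstab : ∀ a ∈ Q, ∀ v, f v = 0 → f (ρ.act a v) = 0) : IsSub ρ (LinearMap.ker f) := by
  refine ⟨hstab, fun v hv => ?_⟩
  obtain ⟨v0, h0, v1, h1, rfl⟩ := ρ.grade_sup v
  have h := eq_zero_of_add_eq_zero_s10 p (by simpa using hf 0 v0 h0) (hf 1 v1 h1)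
    (by rw [← map_add]; exact hv)
  exact ⟨v0, h.1, h0, v1, h.2, h1, rfl⟩

/-- Schur's lemma for even operators. -/
lemma exists_eq_smul_one_of_commute [FiniteDimensional ℂ ρ.V] (hs : IsSimple ρ)
    (f : Module.End ℂ ρ.V) (hf : ∀ q, ∀ v ∈ ρ.grade q, f v ∈ ρ.grade q)
    (hcomm : ∀ a ∈ Q, Commute f (ρ.act a)) : ∃ μ : ℂ, f = μ • 1 := by
  obtain ⟨w, hw⟩ := hs.1
  have : Nontrivial ρ.V := ⟨w, 0, hw⟩
  obtain ⟨μ, hμ⟩ := Module.End.exists_eigenvalue f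
  obtain ⟨v, hv, hv0⟩ := hμ.exists_hasEigenvector
  rw [Module.End.mem_eigenspace_iff] at hv
  refine ⟨μ, sub_eq_zero.1 ?_⟩
  have hsub : IsSub ρ (LinearMap.ker (f - μ • 1)) := by
    refine isSub_ker 0 _ (fun q v hv => ?_) fun a ha v hv => ?_
    · rw [zero_add]
      exact sub_mem (hf q v hv) ((ρ.grade q).smul_mem μ hv)
    · have hc : Commute (f - μ • 1) (ρ.act a) :=
        (hcomm a ha).sub_left ((Commute.one_left _).smul_left μ)
      have := LinearMap.congr_fun hc.eq v
      rw [Module.End.mul_apply, Module.End.mul_apply, hv, map_zero] at this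
      exact this
  rcases hs.2 _ hsub with h | h
  · refine absurd ((Submodule.mem_bot ℂ).1 (h ▸ ?_ : v ∈ (⊥ : Submodule ℂ ρ.V))) hv0
    simp [hv]
  · exact LinearMap.ker_eq_top.1 h

/-- A central even operator which is a multiple of a commutator vanishes. -/
lemma eq_zero_of_commute_of_commutator [FiniteDimensional ℂ ρ.V] (hs : IsSimple ρ)
    (f : Module.End ℂ ρ.V) (hf : ∀ q, ∀ v ∈ ρ.grade q, f v ∈ ρ.grade q)
    (hcomm : ∀ a ∈ Q, Commute f (ρ.act a)) {c : ℂ} (hc : c ≠ 0) {x y : Module.End ℂ ρ.V}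
    (hxy : x * y - y * x = c • f) : f = 0 := by
  obtain ⟨μ, rfl⟩ := exists_eq_smul_one_of_commute hs f hf hcomm
  obtain ⟨w, hw⟩ := hs.1
  have : Nontrivial ρ.V := ⟨w, 0, hw⟩
  have h := congrArg (LinearMap.trace ℂ ρ.V) hxy
  rw [map_sub, LinearMap.trace_mul_comm, sub_self, map_smul, map_smul, LinearMap.trace_one] at h
  have hd : (Module.finrank ℂ ρ.V : ℂ) ≠ 0 := Nat.cast_ne_zero.2 Module.finrank_pos.ne'
  have hμ : μ = 0 := by simpa [hc, hd] using h.symm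
  rw [hμ, zero_smul]

/-- An odd operator which supercommutes with the action and squares to zero vanishes. -/
lemma eq_zero_of_odd_of_sq (hs : IsSimple ρ) (f : Module.End ℂ ρ.V)
    (hf : ∀ q, ∀ v ∈ ρ.grade q, f v ∈ ρ.grade (1 + q))
    (hcomm : ∀ a ∈ Q, ∀ v, f v = 0 → f (ρ.act a v) = 0) (hsq : f * f = 0) : f = 0 := by
  rcases hs.2 _ (isSub_ker 1 f hf hcomm) with h | h
  · ext v
    have hv : f (f v) = 0 := LinearMap.congr_fun hsq v
    exact LinearMap.ker_eq_bot'.1 h _ hv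
  · exact LinearMap.ker_eq_top.1 h

/-- If every basis element acts by a scalar, a simple representation is one-dimensional. -/
lemma finrank_eq_one_of_scalar (hs : IsSimple ρ)
    (h : ∀ a ∈ Q, ∃ μ : ℂ, ρ.act a = μ • (1 : Module.End ℂ ρ.V)) :
    Module.finrank ℂ ρ.V = 1 := by
  have hline : ∀ w : ρ.V, w ∈ ρ.grade 0 ∨ w ∈ ρ.grade 1 → w ≠ 0 → Module.finrank ℂ ρ.V = 1 := by
    intro w hw hw0
    refine finrank_eq_one w hw0 fun x => ?_
    have hsub : IsSub ρ (Submodule.span ℂ {w}) := by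
      refine ⟨fun a ha v hv => ?_, fun v hv => ?_⟩
      · obtain ⟨μ, hμ⟩ := h a ha
        rw [hμ]
        exact Submodule.smul_mem _ μ hv
      · obtain ⟨c, rfl⟩ := Submodule.mem_span_singleton.1 hv
        rcases hw with hw | hw
        · exact ⟨c • w, hv, Submodule.smul_mem _ c hw, 0, zero_mem _, zero_mem _, by simp⟩
        · exact ⟨0, zero_mem _, zero_mem _, c • w, hv, Submodule.smul_mem _ c hw, by simp⟩
    rcases hs.2 _ hsub with h' | h'
    · exact absurd (Submodule.span_singleton_eq_bot.1 h') hw0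
    · exact Submodule.mem_span_singleton.1 (h' ▸ Submodule.mem_top)
  obtain ⟨v, hv⟩ := hs.1
  obtain ⟨v0, h0, v1, h1, rfl⟩ := ρ.grade_sup v
  by_cases hv0 : v0 = 0
  · exact hline v1 (Or.inr h1) (by simpa [hv0] using hv)
  · exact hline v0 (Or.inl h0) hv0

end General

section TOne

variable {ρ : GRep (T 1)}

lemma l_mem_T {n : ℕ} (hn : 1 ≤ n) : SB.l n ∈ T 1 := by
  change ((1 : ℕ) : ℤ) ≤ n; exact_mod_cast hn

lemma i_mem_T {n : ℕ} (hn : 1 ≤ n) : SB.i n ∈ T 1 := by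
  change ((1 : ℕ) : ℤ) ≤ n; exact_mod_cast hn

lemma g_mem_T {n : ℕ} (hn : 1 ≤ n) : SB.g n ∈ T 1 := by
  change ((1 : ℕ) : ℤ) ≤ n; exact_mod_cast hn

lemma forall_mem_T {P : SB → Prop} (hl : ∀ n : ℕ, 1 ≤ n → P (.l n))
    (hi : ∀ n : ℕ, 1 ≤ n → P (.i n)) (hg : ∀ n : ℕ, 1 ≤ n → P (.g n)) : ∀ a ∈ T 1, P a := by
  rintro (m | m | m) hm <;>
  · have hm' : (1 : ℤ) ≤ m := hm
    lift m to ℕ using by omega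
    first
    | exact hl m (by omega)
    | exact hi m (by omega)
    | exact hg m (by omega)

variable (ρ)

/-- The operator by which `L_n` acts. -/
abbrev opL (n : ℕ) : Module.End ℂ ρ.V := ρ.act (.l n)

/-- The operator by which `I_n` acts. -/
abbrev opI (n : ℕ) : Module.End ℂ ρ.V := ρ.act (.i n)

/-- The operator by which `G_n` acts. -/
abbrev opG (n : ℕ) : Module.End ℂ ρ.V := ρ.act (.g n)

lemma opL_opL {m n : ℕ} (hm : 1 ≤ m) (hn : 1 ≤ n) :
    ρ.opL m * ρ.opL n - ρ.opL n * ρ.opL m = ((n : ℂ) - m) • ρ.opL (m + n) := by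
  ext v
  simpa [opL, sgn, par, sb, ← Finsupp.single_sub] using
    ρ.act_br _ (l_mem_T hm) _ (l_mem_T hn) v

lemma opL_opI {m n : ℕ} (hm : 1 ≤ m) (hn : 1 ≤ n) :
    ρ.opL m * ρ.opI n - ρ.opI n * ρ.opL m = (n : ℂ) • ρ.opI (m + n) := by
  ext v
  simpa [opL, opI, opG, sgn, par, sb] using
    ρ.act_br _ (l_mem_T hm) _ (i_mem_T hn) v

lemma opL_opG {m n : ℕ} (hm : 1 ≤ m) (hn : 1 ≤ n) :
    ρ.opL m * ρ.opG n - ρ.opG n * ρ.opL m = (n : ℂ) • ρ.opG (m + n) := by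
  ext v
  simpa [opL, opI, opG, sgn, par, sb] using
    ρ.act_br _ (l_mem_T hm) _ (g_mem_T hn) v

lemma opG_opG {m n : ℕ} (hm : 1 ≤ m) (hn : 1 ≤ n) :
    ρ.opG m * ρ.opG n + ρ.opG n * ρ.opG m = (2 : ℂ) • ρ.opI (m + n) := by
  ext v
  simpa [opL, opI, opG, sgn, par, sb] using
    ρ.act_br _ (g_mem_T hm) _ (g_mem_T hn) v

lemma commute_opI_opI {m n : ℕ} (hm : 1 ≤ m) (hn : 1 ≤ n) :
    Commute (ρ.opI m) (ρ.opI n) := by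
  refine sub_eq_zero.1 ?_
  ext v
  simpa [sgn, par, sb] using ρ.act_br _ (i_mem_T hm) _ (i_mem_T hn) v

lemma commute_opI_opG {m n : ℕ} (hm : 1 ≤ m) (hn : 1 ≤ n) :
    Commute (ρ.opI m) (ρ.opG n) := by
  refine sub_eq_zero.1 ?_
  ext v
  simpa [sgn, par, sb] using ρ.act_br _ (i_mem_T hm) _ (g_mem_T hn) v

lemma opL_grade {n : ℕ} (hn : 1 ≤ n) (q : ZMod 2) (v : ρ.V) (hv : v ∈ ρ.grade q) :
    ρ.opL n v ∈ ρ.grade q := by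
  simpa [par] using ρ.act_grade _ (l_mem_T hn) q v hv

lemma opI_grade {n : ℕ} (hn : 1 ≤ n) (q : ZMod 2) (v : ρ.V) (hv : v ∈ ρ.grade q) :
    ρ.opI n v ∈ ρ.grade q := by
  simpa [par] using ρ.act_grade _ (i_mem_T hn) q v hv

variable {ρ}

lemma commute_opI {n : ℕ} (hn : 1 ≤ n) (hI : ∀ k, n < k → ρ.opI k = 0) :
    ∀ a ∈ T 1, Commute (ρ.opI n) (ρ.act a) := by
  refine forall_mem_T (fun m hm => ?_) (fun m hm => ρ.commute_opI_opI hn hm)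
    (fun m hm => ρ.commute_opI_opG hn hm)
  have h := ρ.opL_opI hm hn
  rw [hI (m + n) (by omega), smul_zero, sub_eq_zero] at h
  exact h.symm

lemma commute_opL {n : ℕ} (hn : 1 ≤ n) (hI : ∀ k, n < k → ρ.opI k = 0)
    (hG : ∀ k, n < k → ρ.opG k = 0) (hL : ∀ k, n < k → 3 ≤ k → ρ.opL k = 0) :
    ∀ a ∈ T 1, Commute (ρ.opL n) (ρ.act a) := by
  refine forall_mem_T (fun m hm => ?_) (fun m hm => ?_) (fun m hm => ?_) <;>
    refine sub_eq_zero.1 ?_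
  · refine (ρ.opL_opL hn hm).trans ?_
    by_cases hmn : m = n
    · simp [hmn]
    · rw [hL _ (by omega) (by omega), smul_zero]
  · refine (ρ.opL_opI hn hm).trans ?_
    rw [hI _ (by omega), smul_zero]
  · refine (ρ.opL_opG hn hm).trans ?_
    rw [hG _ (by omega), smul_zero]

lemma opG_eq_zero (hs : IsSimple ρ) {n : ℕ} (hn : 1 ≤ n) (hI : ∀ k, n < k → ρ.opI k = 0)
    (hG : ∀ k, n < k → ρ.opG k = 0) : ρ.opG n = 0 := by
  refine eq_zero_of_odd_of_sq hs _ (fun q v hv => ρ.act_grade _ (g_mem_T hn) q v hv) ?_ ?_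
  · refine forall_mem_T (fun m hm v hv => ?_) (fun m hm v hv => ?_) (fun m hm v hv => ?_)
    · have h := LinearMap.congr_fun (ρ.opL_opG hm hn) v
      rw [hG (m + n) (by omega)] at h
      simpa [hv] using h
    · have h := LinearMap.congr_fun (ρ.commute_opI_opG hm hn).eq v
      simpa [hv] using h.symm
    · have h := LinearMap.congr_fun (ρ.opG_opG hm hn) v
      rw [hI _ (by omega)] at h
      simpa [hv] using h
  · have h := ρ.opG_opG hn hn
    rw [hI _ (by omega), smul_zero, ← two_smul ℂ] at h
    exact (smul_eq_zero.1 h).resolve_left two_ne_zero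

/-- All operators of sufficiently large degree vanish on a finite-dimensional module. -/
lemma eventually_zero [FiniteDimensional ℂ ρ.V] :
    ∃ N, ∀ k, N ≤ k → ρ.opI k = 0 ∧ ρ.opG k = 0 ∧ ρ.opL k = 0 := by
  obtain ⟨N, hN⟩ := witt_eventually_zero (X := ρ.opL) fun m n hm hn => ρ.opL_opL hm hn
  refine ⟨N + 2, fun k hk => ?_⟩
  obtain ⟨m, rfl⟩ : ∃ m, k = m + 1 := ⟨k - 1, by omega⟩
  have hm := hN m (by omega)
  refine ⟨?_, ?_, hN _ (by omega)⟩
  · simpa [hm] using (ρ.opL_opI (m := m) (n := 1) (by omega) le_rfl).symm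
  · simpa [hm] using (ρ.opL_opG (m := m) (n := 1) (by omega) le_rfl).symm

/-- On a finite-dimensional simple module only `L_1`, `L_2`, `I_1`, `G_1` can act nontrivially. -/
lemma zero_of_two_le [FiniteDimensional ℂ ρ.V] (hs : IsSimple ρ) :
    ∀ k, 2 ≤ k → ρ.opI k = 0 ∧ ρ.opG k = 0 ∧ (3 ≤ k → ρ.opL k = 0) := by
  obtain ⟨N, hN⟩ := ρ.eventually_zero
  have hbase : ∀ k, N + 2 ≤ k → ρ.opI k = 0 ∧ ρ.opG k = 0 ∧ (3 ≤ k → ρ.opL k = 0) := fun k hk =>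
    let h := hN k (by omega); ⟨h.1, h.2.1, fun _ => h.2.2⟩
  intro k hk
  induction h : N + 2 - k using Nat.strong_induction_on generalizing k with
  | _ d ih =>
  by_cases hkN : N + 2 ≤ k
  · exact hbase k hkN
  have hlt : ∀ j, k < j → ρ.opI j = 0 ∧ ρ.opG j = 0 ∧ (3 ≤ j → ρ.opL j = 0) := fun j hj =>
    ih (N + 2 - j) (by omega) j (by omega) rfl
  have hI : ∀ j, k < j → ρ.opI j = 0 := fun j hj => (hlt j hj).1
  have hG : ∀ j, k < j → ρ.opG j = 0 := fun j hj => (hlt j hj).2.1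
  obtain ⟨m, rfl⟩ : ∃ m, k = m + 1 := ⟨k - 1, by omega⟩
  refine ⟨?_, opG_eq_zero hs (by omega) hI hG, fun h3 => ?_⟩
  · exact eq_zero_of_commute_of_commutator hs _ (ρ.opI_grade (by omega))
      (commute_opI (by omega) hI) (Nat.cast_ne_zero.2 one_ne_zero)
      (ρ.opL_opI (m := m) (by omega) le_rfl)
  · refine eq_zero_of_commute_of_commutator hs _ (ρ.opL_grade (by omega))
      (commute_opL (by omega) hI hG fun j hj => (hlt j hj).2.2) ?_
      (ρ.opL_opL (m := m) (by omega) le_rfl)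
    exact sub_ne_zero.2 (Nat.cast_injective.ne (by omega))

end TOne

end GRep

/-- Every finite-dimensional simple module over the Lie superalgebra
`T(1) = 𝔖^{(1,1,1)}` is one-dimensional. -/
theorem finite_dim_simple_T1_module_one_dim (ρ : GRep (T 1))
    (hfd : FiniteDimensional ℂ ρ.V) (hsimple : IsSimple ρ) :
    Module.finrank ℂ ρ.V = 1 := by
  have h2 := GRep.zero_of_two_le hsimple
  have hI : ∀ k, 1 < k → ρ.opI k = 0 := fun k hk => (h2 k hk).1
  have hG : ∀ k, 1 < k → ρ.opG k = 0 := fun k hk => (h2 k hk).2.1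
  have hL : ∀ k, 3 ≤ k → ρ.opL k = 0 := fun k hk => (h2 k (by omega)).2.2 hk
  refine GRep.finrank_eq_one_of_scalar hsimple (GRep.forall_mem_T ?_ ?_ ?_) <;> intro n hn
  · exact GRep.exists_eq_smul_one_of_commute hsimple _ (ρ.opL_grade hn)
      (GRep.commute_opL hn (fun k hk => hI k (by omega)) (fun k hk => hG k (by omega))
        fun k _ hk => hL k hk)
  · exact GRep.exists_eq_smul_one_of_commute hsimple _ (ρ.opI_grade hn)
      (GRep.commute_opI hn fun k hk => hI k (by omega))
  · exact ⟨0, (GRep.opG_eq_zero hsimple hn (fun k hk => hI k (by omega))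
      fun k hk => hG k (by omega)).trans (zero_smul ℂ _).symm⟩
end

section
/- Let k ∈ ℤ≥1 and let φ_k: T(k) → ℂ be a homomorphism of Lie superalgebras, where ℂ is regarded as the one-dimensional abelian, purely even Lie superalgebra. Then φ_k(L_i) = 0 for all i ≥ 2k+1 and φ_k(I_j) = φ_k(G_j) = 0 for all j ≥ 2k. -/
/-- A homomorphism of Lie superalgebras from the subalgebra of 𝔖 spanned by `Q` to ℂ
(the one-dimensional abelian, purely even Lie superalgebra), recorded by its values
`φ : SB → ℂ` on the basis elements of `Q`: it is even (vanishes on odd elements) and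
kills all brackets (since ℂ is abelian). -/
def IsHomToC (Q : Set SB) (φ : SB → ℂ) : Prop :=
  (∀ a ∈ Q, par a = 1 → φ a = 0) ∧
  ∀ a ∈ Q, ∀ b ∈ Q, ((sb a b).sum fun c cc => cc * φ c) = 0

/-- For `k ≥ 1`, any Lie superalgebra homomorphism `φₖ : T(k) → ℂ`
satisfies `φₖ(L_i) = 0` for `i ≥ 2k+1` and `φₖ(I_j) = φₖ(G_j) = 0` for `j ≥ 2k`. -/
theorem hom_Tk_vanishing (k : ℕ) (hk : 1 ≤ k) (φ : SB → ℂ) (hφ : IsHomToC (T k) φ) :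
    (∀ i : ℤ, 2 * (k : ℤ) + 1 ≤ i → φ (.l i) = 0) ∧
    (∀ j : ℤ, 2 * (k : ℤ) ≤ j → φ (.i j) = 0 ∧ φ (.g j) = 0) := by
  refine ⟨fun i hi => ?_, fun j hj => ⟨?_, ?_⟩⟩
  · have h := hφ.2 (.l k) (show (k : ℤ) ≤ k from le_rfl) (.l (i - k))
      (show (k : ℤ) ≤ i - k by lia)
    have hne : ((i - k : ℤ) : ℂ) - ((k : ℤ) : ℂ) ≠ 0 := by
      rw [← Int.cast_sub]
      exact Int.cast_ne_zero.mpr (by lia)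
    rw [sb, add_sub_cancel, Finsupp.smul_single, Finsupp.sum_single_index (zero_mul _),
      smul_eq_mul, mul_one] at h
    exact (mul_eq_zero.mp h).resolve_left hne
  · have h := hφ.2 (.g k) (show (k : ℤ) ≤ k from le_rfl) (.g (j - k))
      (show (k : ℤ) ≤ j - k by lia)
    rw [sb, add_sub_cancel, Finsupp.smul_single, Finsupp.sum_single_index (zero_mul _),
      smul_eq_mul, mul_one] at h
    exact (mul_eq_zero.mp h).resolve_left two_ne_zero
  · exact hφ.1 (.g j) (show (k : ℤ) ≤ j by lia) rfl
end
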